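/- Let a, b ∈ ℂ with Re a > 0 and Re b > 0, and let g(x) = 1/(e^{ax} + e^{-bx}). If Λ ⊂ ℝ is a separated set with D⁻(Λ) > 1, then Λ contains a subset which is a complete interpolating sequence for V²(g). -/

import Mathlib

open MeasureTheory Filter Metric Complex

noncomputable section

/-- A set `Λ ⊆ ℝ` is separated. -/
def Separated (Λ : Set ℝ) : Prop :=
  ∃ δ : ℝ, 0 < δ ∧ ∀ x ∈ Λ, ∀ y ∈ Λ, x ≠ y → δ ≤ |x - y|

/-- Lower Beurling density. -/
def lowerDensity (Λ : Set ℝ) : ℝ :=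
  liminf (fun r : ℝ => ⨅ x : ℝ, ((Λ ∩ Set.Icc x (x + r)).ncard : ℝ) / r) atTop

def upperDensity (Λ : Set ℝ) : ℝ :=
  limsup (fun r : ℝ => ⨆ x : ℝ, ((Λ ∩ Set.Icc x (x + r)).ncard : ℝ) / r) atTop

/-- Gabor coefficient. -/
def gaborCoef (g f : ℝ → ℂ) (p : ℝ × ℝ) : ℂ :=
  ∫ t : ℝ, f t * (starRingEnd ℂ) (Complex.exp (-2 * Real.pi * Complex.I * p.2 * t) * g (p.1 - t))

def IsGaborFrame (g : ℝ → ℂ) (S : Set (ℝ × ℝ)) : Prop :=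
  ∃ A B : ℝ, 0 < A ∧ 0 < B ∧ ∀ f : ℝ → ℂ, MemLp f 2 (volume : Measure ℝ) →
    A * (∫ t : ℝ, ‖f t‖ ^ 2) ≤ (∑' p : S, ‖gaborCoef g f p‖ ^ 2) ∧
    (∑' p : S, ‖gaborCoef g f p‖ ^ 2) ≤ B * (∫ t : ℝ, ‖f t‖ ^ 2)

/-- membership in shift invariant space -/
def InV2 (g : ℝ → ℂ) (f : ℝ → ℂ) : Prop :=
  ∃ c : ℤ → ℂ, Memℓp c 2 ∧ ∀ x : ℝ, HasSum (fun n : ℤ => c n * g (x - n)) (f x)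

def IsSamplingSet (g : ℝ → ℂ) (Λ : Set ℝ) : Prop :=
  ∃ A B : ℝ, 0 < A ∧ 0 < B ∧ ∀ f : ℝ → ℂ, InV2 g f →
    A * (∫ t : ℝ, ‖f t‖ ^ 2) ≤ (∑' l : Λ, ‖f l‖ ^ 2) ∧
    (∑' l : Λ, ‖f l‖ ^ 2) ≤ B * (∫ t : ℝ, ‖f t‖ ^ 2)

def IsInterpolatingSet (g : ℝ → ℂ) (Λ : Set ℝ) : Prop :=
  ∀ a : Λ → ℂ, Memℓp a 2 → ∃ f : ℝ → ℂ, InV2 g f ∧ ∀ l : Λ, f l = a l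

def IsSamplingSeqV (g : ℝ → ℂ) (lam : ℤ → ℝ) : Prop :=
  ∃ A B : ℝ, 0 < A ∧ 0 < B ∧ ∀ f : ℝ → ℂ, InV2 g f →
    A * (∫ t : ℝ, ‖f t‖ ^ 2) ≤ (∑' m : ℤ, ‖f (lam m)‖ ^ 2) ∧
    (∑' m : ℤ, ‖f (lam m)‖ ^ 2) ≤ B * (∫ t : ℝ, ‖f t‖ ^ 2)

/-- Fock weight function φ. -/
def phiF (β γ : ℝ) (z : ℂ) : ℝ :=
  β * (Real.log ‖z‖) ^ 2 + γ * Real.log ‖z‖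

def MemFock (β γ : ℝ) (F : ℂ → ℂ) : Prop :=
  DifferentiableOn ℂ F {(0 : ℂ)}ᶜ ∧
    Integrable (fun z : ℂ => ‖F z‖ ^ 2 * Real.exp (-2 * phiF β γ z)) volume

def fockNormSq (β γ : ℝ) (F : ℂ → ℂ) : ℝ :=
  (1 / Real.pi) * ∫ z : ℂ, ‖F z‖ ^ 2 * Real.exp (-2 * phiF β γ z)

def fockWeight (β γ : ℝ) (w : ℂ) : ℝ :=
  (1 + ‖w‖ ^ 2) * Real.exp (-2 * phiF β γ w)

def IsFockSamplingSeq (β γ : ℝ) (u : ℤ → ℂ) : Prop :=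
  ∃ A B : ℝ, 0 < A ∧ 0 < B ∧ ∀ F : ℂ → ℂ, MemFock β γ F →
    A * fockNormSq β γ F ≤ (∑' m : ℤ, fockWeight β γ (u m) * ‖F (u m)‖ ^ 2) ∧
    (∑' m : ℤ, fockWeight β γ (u m) * ‖F (u m)‖ ^ 2) ≤ B * fockNormSq β γ F

def IsFockInterpolatingSeq (β γ : ℝ) (u : ℤ → ℂ) : Prop :=
  ∀ a : ℤ → ℂ, Summable (fun m : ℤ => fockWeight β γ (u m) * ‖a m‖ ^ 2) →
    ∃ F : ℂ → ℂ, MemFock β γ F ∧ ∀ m : ℤ, F (u m) = a m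

def IsFockSamplingSet (β γ : ℝ) (Λ : Set ℂ) : Prop :=
  ∃ A B : ℝ, 0 < A ∧ 0 < B ∧ ∀ F : ℂ → ℂ, MemFock β γ F →
    A * fockNormSq β γ F ≤ (∑' w : Λ, fockWeight β γ w * ‖F w‖ ^ 2) ∧
    (∑' w : Λ, fockWeight β γ w * ‖F w‖ ^ 2) ≤ B * fockNormSq β γ F

def IsFockInterpolatingSet (β γ : ℝ) (Λ : Set ℂ) : Prop :=
  ∀ a : Λ → ℂ, Summable (fun w : Λ => fockWeight β γ (w : ℂ) * ‖a w‖ ^ 2) →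
    ∃ F : ℂ → ℂ, MemFock β γ F ∧ ∀ w : Λ, F w = a w

/-- the canonical product A(z) -/
def Afun (a b : ℂ) (z : ℂ) : ℂ :=
  ∏' n : ℕ, (1 + z * Complex.exp (-(a + b) * (n + 1)))

def Gfun (a b : ℂ) (z : ℂ) : ℂ := (1 + z) * Afun a b z * Afun a b (1 / z)

/-- the discrete Cauchy transform G(z) Σ c_n e^{an}/(z+e^{(a+b)n}) -/
def cauchyT (a b : ℂ) (c : ℤ → ℂ) (z : ℂ) : ℂ :=
  Gfun a b z * ∑' n : ℤ, c n * Complex.exp (a * n) / (z + Complex.exp ((a + b) * n))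

/-- norm of the evaluation functional at `w` on `H_{a,b}` -/
def Hnorm (a b : ℂ) (w : ℂ) : ℝ :=
  sSup {r : ℝ | ∃ c : ℤ → ℂ, Memℓp c 2 ∧ (∑' n : ℤ, ‖c n‖ ^ 2) ≤ 1 ∧ r = ‖cauchyT a b c w‖}

def IsSamplingSeqH (a b : ℂ) (u : ℤ → ℂ) : Prop :=
  ∃ A B : ℝ, 0 < A ∧ 0 < B ∧ ∀ c : ℤ → ℂ, Memℓp c 2 →
    A * (∑' n : ℤ, ‖c n‖ ^ 2) ≤ (∑' m : ℤ, ((Hnorm a b (u m)) ^ 2)⁻¹ * ‖cauchyT a b c (u m)‖ ^ 2) ∧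
    (∑' m : ℤ, ((Hnorm a b (u m)) ^ 2)⁻¹ * ‖cauchyT a b c (u m)‖ ^ 2) ≤ B * (∑' n : ℤ, ‖c n‖ ^ 2)

/-- The total mass of the two-sided exponential `k ↦ exp (-ε |k|)` on `ℤ`. -/
def expMass (ε : ℝ) : ℝ := ∑' k : ℤ, Real.exp (-ε * |(k : ℝ)|)

lemma summable_exp_neg_mul_abs {ε : ℝ} (hε : 0 < ε) :
    Summable fun k : ℤ => Real.exp (-ε * |(k : ℝ)|) := by
  have h : Summable fun n : ℕ => Real.exp (-ε * |((n : ℤ) : ℝ)|) := by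
    have := Real.summable_exp_nat_mul_iff.mpr (neg_lt_zero.mpr hε)
    refine this.congr fun n => ?_
    congr 1
    simp [mul_comm]
  exact Summable.of_nat_of_neg h (by simpa using h)

lemma summable_exp_neg_mul_abs_sub {ε : ℝ} (hε : 0 < ε) (m : ℤ) :
    Summable fun k : ℤ => Real.exp (-ε * |(m : ℝ) - k|) := by
  refine ((Equiv.subLeft m).summable_iff.mpr (summable_exp_neg_mul_abs hε)).congr fun k => ?_
  simp

lemma tsum_exp_neg_mul_abs_sub (ε : ℝ) (m : ℤ) :
    ∑' k : ℤ, Real.exp (-ε * |(m : ℝ) - k|) = expMass ε := by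
  rw [expMass, ← (Equiv.subLeft m).tsum_eq]
  simp

lemma expMass_pos {ε : ℝ} (hε : 0 < ε) : 0 < expMass ε :=
  (summable_exp_neg_mul_abs hε).tsum_pos (fun _ => (Real.exp_pos _).le) 0 (Real.exp_pos _)

lemma sum_exp_neg_mul_abs_sub_le {ε : ℝ} (hε : 0 < ε) (m : ℤ) (s : Finset ℤ) :
    ∑ k ∈ s, Real.exp (-ε * |(m : ℝ) - k|) ≤ expMass ε := by
  rw [← tsum_exp_neg_mul_abs_sub ε m]
  exact (summable_exp_neg_mul_abs_sub hε m).sum_le_tsum _ fun _ _ => (Real.exp_pos _).le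

/-- Weighted Cauchy-Schwarz inequality for series. -/
lemma sq_tsum_mul_le {ι : Type*} {w u : ι → ℝ} (hw : ∀ i, 0 ≤ w i) (hs : Summable w)
    (hs1 : Summable fun i => w i * u i) (hs2 : Summable fun i => w i * u i ^ 2)
    (hpos : 0 < ∑' i, w i) :
    (∑' i, w i * u i) ^ 2 ≤ (∑' i, w i) * ∑' i, w i * u i ^ 2 := by
  set A := ∑' i, w i
  set B := ∑' i, w i * u i
  set D := ∑' i, w i * u i ^ 2
  have h : ∑' i, w i * (A * u i - B) ^ 2 = A ^ 2 * D - 2 * A * B * B + B ^ 2 * A := by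
    have h1 := ((hs2.hasSum.mul_left (A ^ 2)).sub (hs1.hasSum.mul_left (2 * A * B))).add
      (hs.hasSum.mul_left (B ^ 2))
    rw [← h1.tsum_eq]
    exact tsum_congr fun i => by ring
  have h0 : 0 ≤ ∑' i, w i * (A * u i - B) ^ 2 :=
    tsum_nonneg fun i => mul_nonneg (hw i) (sq_nonneg _)
  rw [h] at h0
  have h2 : 0 ≤ A * (A * D - B ^ 2) := by nlinarith
  nlinarith [nonneg_of_mul_nonneg_right h2 hpos]

lemma norm_le_sqrt_tsum {c : ℤ → ℂ} (hc : Summable fun n => ‖c n‖ ^ 2) (n : ℤ) :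
    ‖c n‖ ≤ Real.sqrt (∑' n, ‖c n‖ ^ 2) :=
  Real.le_sqrt_of_sq_le (hc.le_tsum n fun _ _ => sq_nonneg _)

lemma summable_kernel_mul {ε C A : ℝ} (hε : 0 < ε) {κ c : ℤ → ℂ} (m : ℤ)
    (hκ : ∀ n, ‖κ n‖ ≤ C * Real.exp (-ε * |(m : ℝ) - n|)) (hc : ∀ n, ‖c n‖ ≤ A) :
    Summable fun n => ‖κ n * c n‖ := by
  refine Summable.of_nonneg_of_le (fun _ => norm_nonneg _) (fun n => ?_)
    ((summable_exp_neg_mul_abs_sub hε m).mul_left (C * A))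
  rw [norm_mul]
  calc ‖κ n‖ * ‖c n‖ ≤ (C * Real.exp (-ε * |(m : ℝ) - n|)) * A :=
        mul_le_mul (hκ n) (hc n) (norm_nonneg _) ((norm_nonneg _).trans (hκ n))
    _ = _ := by ring

/-- Schur test for kernels on `ℤ × ℤ` with exponential off-diagonal decay. -/
lemma schur_test {ε C : ℝ} (hε : 0 < ε) {κ : ℤ → ℤ → ℂ}
    (hκ : ∀ m n, ‖κ m n‖ ≤ C * Real.exp (-ε * |(m : ℝ) - n|)) {c : ℤ → ℂ}
    (hc : Summable fun n => ‖c n‖ ^ 2) :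
    (Summable fun m => ‖∑' n, κ m n * c n‖ ^ 2) ∧
      ∑' m, ‖∑' n, κ m n * c n‖ ^ 2 ≤ (C * expMass ε) ^ 2 * ∑' n, ‖c n‖ ^ 2 := by
  set A := Real.sqrt (∑' n, ‖c n‖ ^ 2)
  have hcA : ∀ n, ‖c n‖ ≤ A := norm_le_sqrt_tsum hc
  set w : ℤ → ℤ → ℝ := fun m n => Real.exp (-ε * |(m : ℝ) - n|) with hw
  have hw0 : ∀ m n, 0 ≤ w m n := fun _ _ => (Real.exp_pos _).le
  have hws : ∀ m, Summable (w m) := summable_exp_neg_mul_abs_sub hε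
  have hwc : ∀ m, Summable fun n => w m n * ‖c n‖ := fun m =>
    Summable.of_nonneg_of_le (fun n => mul_nonneg (hw0 m n) (norm_nonneg _))
      (fun n => mul_le_mul_of_nonneg_left (hcA n) (hw0 m n)) ((hws m).mul_right A)
  have hwc2 : ∀ m, Summable fun n => w m n * ‖c n‖ ^ 2 := fun m =>
    Summable.of_nonneg_of_le (fun n => mul_nonneg (hw0 m n) (sq_nonneg _))
      (fun n => mul_le_mul_of_nonneg_left (pow_le_pow_left₀ (norm_nonneg _) (hcA n) 2) (hw0 m n))
      ((hws m).mul_right (A ^ 2))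
  have hprod : Summable fun p : ℤ × ℤ => w p.1 p.2 * ‖c p.2‖ ^ 2 := by
    have h := (summable_exp_neg_mul_abs hε).mul_of_nonneg hc (fun _ => (Real.exp_pos _).le)
      (fun _ => sq_nonneg _)
    let e : ℤ × ℤ ≃ ℤ × ℤ :=
      ⟨fun p => (p.1 - p.2, p.2), fun p => (p.1 + p.2, p.2), fun p => by simp, fun p => by simp⟩
    refine (e.summable_iff.mpr h).congr fun p => ?_
    simp [e, hw]
  have hsum : ∑' m, ∑' n, w m n * ‖c n‖ ^ 2 = expMass ε * ∑' n, ‖c n‖ ^ 2 := by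
    rw [← Summable.tsum_comm (f := fun m n => w m n * ‖c n‖ ^ 2) hprod, ← tsum_mul_left]
    refine tsum_congr fun n => ?_
    rw [tsum_mul_right, ← tsum_exp_neg_mul_abs_sub ε n]
    congr 1
    exact tsum_congr fun m => by simp only [hw, abs_sub_comm]
  have hpt : ∀ m, ‖∑' n, κ m n * c n‖ ^ 2 ≤
      C ^ 2 * expMass ε * ∑' n, w m n * ‖c n‖ ^ 2 := by
    intro m
    have hle : ‖∑' n, κ m n * c n‖ ≤ C * ∑' n, w m n * ‖c n‖ := by
      rw [← tsum_mul_left]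
      refine (norm_tsum_le_tsum_norm (summable_kernel_mul hε m (hκ m) hcA)).trans
        ((summable_kernel_mul hε m (hκ m) hcA).tsum_le_tsum (fun n => ?_) ((hwc m).mul_left C))
      rw [norm_mul, ← mul_assoc]
      exact mul_le_mul_of_nonneg_right (hκ m n) (norm_nonneg _)
    have hmass : ∑' n, w m n = expMass ε := tsum_exp_neg_mul_abs_sub ε m
    have hcs := sq_tsum_mul_le (hw0 m) (hws m) (hwc m) (hwc2 m) (hmass ▸ expMass_pos hε)
    rw [hmass] at hcs
    calc ‖∑' n, κ m n * c n‖ ^ 2 ≤ (C * ∑' n, w m n * ‖c n‖) ^ 2 :=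
          pow_le_pow_left₀ (norm_nonneg _) hle 2
      _ = C ^ 2 * (∑' n, w m n * ‖c n‖) ^ 2 := by ring
      _ ≤ C ^ 2 * (expMass ε * ∑' n, w m n * ‖c n‖ ^ 2) :=
          mul_le_mul_of_nonneg_left hcs (sq_nonneg _)
      _ = _ := by ring
  have hS : Summable fun m => C ^ 2 * expMass ε * ∑' n, w m n * ‖c n‖ ^ 2 :=
    (hprod.prod).mul_left _
  have hS' := Summable.of_nonneg_of_le (fun m => sq_nonneg _) hpt hS
  refine ⟨hS', (hS'.tsum_le_tsum hpt hS).trans_eq ?_⟩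
  rw [tsum_mul_left, hsum]
  ring

/-- Associativity of the action of two exponentially decaying kernels on bounded sequences. -/
lemma tsum_kernel_assoc {ε C C' A : ℝ} (hε : 0 < ε) {κ κ' : ℤ → ℤ → ℂ}
    (hκ : ∀ m n, ‖κ m n‖ ≤ C * Real.exp (-ε * |(m : ℝ) - n|))
    (hκ' : ∀ m n, ‖κ' m n‖ ≤ C' * Real.exp (-ε * |(m : ℝ) - n|))
    {c : ℤ → ℂ} (hc : ∀ n, ‖c n‖ ≤ A) (m : ℤ) :
    ∑' n, κ m n * ∑' k, κ' n k * c k = ∑' k, (∑' n, κ m n * κ' n k) * c k := by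
  have hC : 0 ≤ C := by
    simpa using (norm_nonneg _).trans (hκ 0 0)
  have hC' : 0 ≤ C' := by
    simpa using (norm_nonneg _).trans (hκ' 0 0)
  have hA : 0 ≤ A := (norm_nonneg _).trans (hc 0)
  have hprod : Summable fun p : ℤ × ℤ => κ m p.1 * (κ' p.1 p.2 * c p.2) := by
    have h := (summable_exp_neg_mul_abs_sub hε m).mul_of_nonneg (summable_exp_neg_mul_abs hε)
      (fun _ => (Real.exp_pos _).le) (fun _ => (Real.exp_pos _).le)
    let e : ℤ × ℤ ≃ ℤ × ℤ :=
      ⟨fun p => (p.1, p.1 - p.2), fun p => (p.1, p.1 - p.2), fun p => by simp, fun p => by simp⟩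
    refine Summable.of_norm_bounded ((e.summable_iff.mpr h).mul_left (C * C' * A)) fun p => ?_
    rw [norm_mul, norm_mul]
    calc ‖κ m p.1‖ * (‖κ' p.1 p.2‖ * ‖c p.2‖)
        ≤ (C * Real.exp (-ε * |(m : ℝ) - p.1|)) *
          ((C' * Real.exp (-ε * |(p.1 : ℝ) - p.2|)) * A) := by
          gcongr
          · exact hκ _ _
          · exact hκ' _ _
          · exact hc _
      _ = _ := by
          simp [e]
          ring
  have h1 : ∀ n, ∑' k, κ m n * (κ' n k * c k) = κ m n * ∑' k, κ' n k * c k :=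
    fun n => tsum_mul_left
  have h2 : ∀ k, ∑' n, κ m n * (κ' n k * c k) = (∑' n, κ m n * κ' n k) * c k := fun k => by
    rw [← tsum_mul_right]
    exact tsum_congr fun n => by ring
  rw [← tsum_congr h1, ← tsum_congr h2]
  exact (Summable.tsum_comm (f := fun n k => κ m n * (κ' n k * c k)) hprod).symm

lemma exp_add_exp_le (u v : ℝ) :
    Real.exp u + Real.exp v ≤ Real.exp u * Real.exp (Real.exp (v - u)) := by
  have h : Real.exp v = Real.exp u * Real.exp (v - u) := by rw [← Real.exp_add]; ring_nf
  nlinarith [Real.add_one_le_exp (Real.exp (v - u)), Real.exp_pos u]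

lemma exp_neg_div_le_one_sub {q x : ℝ} (hx : 0 ≤ x) (hxq : x ≤ q) (hq : q < 1) :
    Real.exp (-(x / (1 - q))) ≤ 1 - x := by
  have h1 : x / (1 - x) ≤ x / (1 - q) :=
    div_le_div_of_nonneg_left hx (by linarith) (by linarith)
  have h2 : (1 - x)⁻¹ ≤ Real.exp (x / (1 - q)) := by
    have h3 : (1 - x)⁻¹ = x / (1 - x) + 1 := by
      have : 1 - x ≠ 0 := by linarith
      field_simp
      ring
    rw [h3]
    exact (add_le_add_left h1 1).trans (Real.add_one_le_exp _)
  rw [Real.exp_neg]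
  exact inv_le_of_inv_le₀ (by linarith) h2

lemma exp_mul_one_sub_le_abs (u v : ℝ) :
    Real.exp u * (1 - Real.exp (-|u - v|)) ≤ |Real.exp u - Real.exp v| := by
  rcases le_total v u with h | h
  · rw [abs_of_nonneg (sub_nonneg.mpr h), mul_sub, mul_one, ← Real.exp_add]
    refine le_trans (le_of_eq ?_) (le_abs_self _)
    ring_nf
  · rw [abs_of_nonpos (sub_nonpos.mpr h), abs_sub_comm]
    refine le_trans ?_ (le_abs_self _)
    have h1 : Real.exp u = Real.exp v * Real.exp (u - v) := by rw [← Real.exp_add]; ring_nf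
    have h2 : Real.exp u ≤ Real.exp v := Real.exp_le_exp.mpr h
    have h3 : Real.exp (- -(u - v)) = Real.exp (u - v) := by ring_nf
    have h4 : Real.exp (u - v) ≤ 1 := Real.exp_le_one_iff.mpr (by linarith)
    rw [h3]
    calc Real.exp u * (1 - Real.exp (u - v)) ≤ Real.exp v * (1 - Real.exp (u - v)) :=
          mul_le_mul_of_nonneg_right h2 (by linarith)
      _ = _ := by rw [mul_sub, mul_one, ← h1]

/-- The explicit inverse of a finite Cauchy matrix `1 / (z m + w n)`, via Lagrange interpolation. -/
lemma cauchy_left_inverse {ι F : Type*} [DecidableEq ι] [Field F] (s : Finset ι) (z w : ι → F)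
    (hz : Set.InjOn z s) (hw : Set.InjOn w s) (hzw : ∀ m ∈ s, ∀ n ∈ s, z m + w n ≠ 0)
    {n n' : ι} (hn : n ∈ s) (hn' : n' ∈ s) :
    ∑ m ∈ s, ((∏ j ∈ s.erase n, (z m + w j)) * (-∏ k ∈ s, (-w n - z k)) /
        ((∏ k ∈ s.erase m, (z m - z k)) * ∏ j ∈ s.erase n, (-w n + w j))) * (z m + w n')⁻¹ =
      if n = n' then 1 else 0 := by
  classical
  let P : Polynomial F := ∏ j ∈ s.erase n, (Polynomial.X + Polynomial.C (w j))
  have hPe : ∀ x, P.eval x = ∏ j ∈ s.erase n, (x + w j) := fun x => by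
    simp [P, Polynomial.eval_prod]
  have hdeg : P.degree < s.card := by
    rw [Polynomial.degree_prod]
    simp only [Polynomial.degree_X_add_C, Finset.sum_const, nsmul_eq_mul, mul_one]
    exact_mod_cast Finset.card_lt_card (Finset.erase_ssubset hn)
  have hx : ∀ i ∈ s, -w n' ≠ z i := fun i hi h => hzw i hi n' hn' (by rw [← h]; ring)
  have key := Lagrange.eval_interpolate_not_at_node (s := s) (v := z)
    (r := fun i => P.eval (z i)) hx
  rw [← Lagrange.eq_interpolate hz hdeg, Lagrange.eval_nodal] at key
  have hne : ∏ k ∈ s, (-w n' - z k) ≠ 0 :=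
    Finset.prod_ne_zero_iff.mpr fun k hk => sub_ne_zero.mpr (hx k hk)
  have hsum : ∑ m ∈ s, (∏ j ∈ s.erase n, (z m + w j)) / (∏ k ∈ s.erase m, (z m - z k)) *
      (z m + w n')⁻¹ = -(P.eval (-w n') / ∏ k ∈ s, (-w n' - z k)) := by
    rw [key, mul_div_cancel_left₀ _ hne, ← Finset.sum_neg_distrib]
    refine Finset.sum_congr rfl fun m hm => ?_
    rw [hPe, Lagrange.nodalWeight, Finset.prod_inv_distrib,
      show -w n' - z m = -(z m + w n') by ring, inv_neg]
    ring
  have hfac : ∀ m, ((∏ j ∈ s.erase n, (z m + w j)) * (-∏ k ∈ s, (-w n - z k)) /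
        ((∏ k ∈ s.erase m, (z m - z k)) * ∏ j ∈ s.erase n, (-w n + w j))) * (z m + w n')⁻¹ =
      (-∏ k ∈ s, (-w n - z k)) / (∏ j ∈ s.erase n, (-w n + w j)) *
        ((∏ j ∈ s.erase n, (z m + w j)) / (∏ k ∈ s.erase m, (z m - z k)) * (z m + w n')⁻¹) := by
    intro m
    rw [mul_div_mul_comm]
    ring
  rw [Finset.sum_congr rfl fun m _ => hfac m, ← Finset.mul_sum, hsum, hPe]
  split_ifs with h
  · subst h
    have hne' : ∏ j ∈ s.erase n, (-w n + w j) ≠ 0 :=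
      Finset.prod_ne_zero_iff.mpr fun j hj h0 => by
        have hj' := Finset.mem_erase.mp hj
        exact hj'.1 (hw hj'.2 hn (by linear_combination h0))
    field_simp
  · have h0 : ∏ j ∈ s.erase n, (-w n' + w j) = 0 :=
      Finset.prod_eq_zero (Finset.mem_erase.mpr ⟨Ne.symm h, hn'⟩) (neg_add_cancel _)
    rw [h0]
    simp

lemma sum_Ico_int_eq_sub {U d : ℤ → ℝ} (hU : ∀ k, U (k + 1) - U k = d k) {p q : ℤ} (h : p ≤ q) :
    ∑ k ∈ Finset.Ico p q, d k = U q - U p := by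
  induction q, h using Int.leInduction with
  | base => simp
  | succ q hq ih =>
    rw [← Finset.insert_Ico_right_eq_Ico_add_one hq, Finset.sum_insert (by simp), ih, ← hU q]
    ring

lemma sum_Ico_int_ite {U d : ℤ → ℝ} (hU : ∀ k, U (k + 1) - U k = d k) {p q m : ℤ}
    (hm : m ∈ Finset.Ico p q) :
    ∑ k ∈ Finset.Ico p q, (if k ≤ m then 0 else d k) = U q - U (m + 1) := by
  rw [Finset.mem_Ico] at hm
  rw [← sum_Ico_int_eq_sub hU (show m + 1 ≤ q by omega), Finset.sum_ite, Finset.sum_const_zero,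
    zero_add]
  congr 1
  ext k
  simp only [Finset.mem_filter, Finset.mem_Ico]
  omega

lemma norm_exp_mul_ofReal (s : ℂ) (x : ℝ) : ‖cexp (s * x)‖ = Real.exp (s.re * x) := by
  simp [Complex.norm_exp]

lemma norm_exp_add_exp_le {s : ℂ} (hs : 0 < s.re) {C : ℝ} {u v : ℤ → ℝ}
    (hu : ∀ k, |u k - k| ≤ C) (hv : ∀ k, |v k - k| ≤ C) (m j : ℤ) :
    ‖cexp (s * u m) + cexp (s * v j)‖ ≤
      Real.exp (s.re * (if j ≤ m then u m else v j) +
        Real.exp (2 * (s.re * C)) * Real.exp (-s.re * |(m : ℝ) - j|)) := by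
  have hum := abs_le.mp (hu m)
  have hvj := abs_le.mp (hv j)
  refine (norm_add_le _ _).trans ?_
  rw [norm_exp_mul_ofReal, norm_exp_mul_ofReal, Real.exp_add, ← Real.exp_add (2 * (s.re * C))]
  split_ifs with h
  · have h' : (j : ℝ) ≤ m := by exact_mod_cast h
    refine (exp_add_exp_le _ _).trans ?_
    rw [abs_of_nonneg (sub_nonneg.mpr h')]
    gcongr
    have : v j - u m ≤ 2 * C - (m - j) := by linarith
    nlinarith
  · have h' : (m : ℝ) ≤ j := by exact_mod_cast (not_le.mp h).le
    rw [add_comm]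
    refine (exp_add_exp_le _ _).trans ?_
    rw [abs_of_nonpos (sub_nonpos.mpr h')]
    gcongr
    have : u m - v j ≤ 2 * C - (j - m) := by linarith
    nlinarith

lemma le_norm_exp_sub_exp {s : ℂ} (hs : 0 < s.re) {C δ : ℝ} (hδ : 0 < δ) {u : ℤ → ℝ}
    (hu : ∀ k, |u k - k| ≤ C) (hsep : ∀ k m, k ≠ m → δ ≤ |u k - u m|) {m k : ℤ} (hk : k ≠ m) :
    Real.exp (s.re * (if k ≤ m then u m else u k) -
        Real.exp (2 * (s.re * C)) / (1 - Real.exp (-(s.re * δ))) *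
          Real.exp (-s.re * |(m : ℝ) - k|)) ≤
      ‖cexp (s * u m) - cexp (s * u k)‖ := by
  set σ := s.re
  set q := Real.exp (-(σ * δ))
  set x := Real.exp (-(σ * |u m - u k|))
  have hq : q < 1 := Real.exp_lt_one_iff.mpr (by nlinarith)
  have hxq : x ≤ q := by
    refine Real.exp_le_exp.mpr (neg_le_neg ?_)
    exact mul_le_mul_of_nonneg_left (hsep m k hk.symm) hs.le
  have hx : x ≤ Real.exp (2 * (σ * C)) * Real.exp (-σ * |(m : ℝ) - k|) := by
    rw [← Real.exp_add]
    refine Real.exp_le_exp.mpr ?_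
    have h1 : |(m : ℝ) - k| ≤ |u m - u k| + 2 * C := by
      have := abs_le.mp (hu m)
      have := abs_le.mp (hu k)
      have := le_abs_self (u m - u k)
      have := neg_abs_le (u m - u k)
      exact abs_le.mpr ⟨by linarith, by linarith⟩
    nlinarith
  have h1x := exp_neg_div_le_one_sub (Real.exp_pos _).le hxq hq
  have hnorm : |Real.exp (σ * u m) - Real.exp (σ * u k)| ≤ ‖cexp (s * u m) - cexp (s * u k)‖ := by
    rw [← norm_exp_mul_ofReal, ← norm_exp_mul_ofReal]
    exact abs_norm_sub_norm_le _ _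
  have hσ : ∀ p r : ℝ, |σ * p - σ * r| = σ * |p - r| := fun p r => by
    rw [← mul_sub, abs_mul, abs_of_pos hs]
  have hexp : Real.exp (-(Real.exp (2 * (σ * C)) / (1 - q) * Real.exp (-σ * |(m : ℝ) - k|))) ≤
      1 - x := by
    refine le_trans (Real.exp_le_exp.mpr (neg_le_neg ?_)) h1x
    rw [div_mul_eq_mul_div]
    exact div_le_div_of_nonneg_right hx (by linarith)
  refine le_trans ?_ hnorm
  rw [sub_eq_add_neg, Real.exp_add]
  split_ifs with h
  · have := exp_mul_one_sub_le_abs (σ * u m) (σ * u k)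
    rw [hσ] at this
    exact (mul_le_mul_of_nonneg_left hexp (Real.exp_pos _).le).trans this
  · have := exp_mul_one_sub_le_abs (σ * u k) (σ * u m)
    rw [hσ, abs_sub_comm (u k), abs_sub_comm (Real.exp _)] at this
    exact (mul_le_mul_of_nonneg_left hexp (Real.exp_pos _).le).trans this

lemma prod_norm_exp_add_exp_le {s : ℂ} (hs : 0 < s.re) {C : ℝ} {u v : ℤ → ℝ}
    (hu : ∀ k, |u k - k| ≤ C) (hv : ∀ k, |v k - k| ≤ C) (m : ℤ) (t : Finset ℤ) :
    ∏ j ∈ t, ‖cexp (s * u m) + cexp (s * v j)‖ ≤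
      Real.exp (s.re * ∑ j ∈ t, (if j ≤ m then u m else v j) +
        Real.exp (2 * (s.re * C)) * expMass s.re) := by
  refine (Finset.prod_le_prod (fun _ _ => norm_nonneg _)
    fun j _ => norm_exp_add_exp_le hs hu hv m j).trans ?_
  rw [← Real.exp_sum, Finset.sum_add_distrib, ← Finset.mul_sum, ← Finset.mul_sum]
  gcongr
  exact sum_exp_neg_mul_abs_sub_le hs m t

lemma le_prod_norm_exp_sub_exp {s : ℂ} (hs : 0 < s.re) {C δ : ℝ} (hδ : 0 < δ) {u : ℤ → ℝ}
    (hu : ∀ k, |u k - k| ≤ C) (hsep : ∀ k m, k ≠ m → δ ≤ |u k - u m|) (m : ℤ) (t : Finset ℤ) :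
    Real.exp (s.re * ∑ k ∈ t.erase m, (if k ≤ m then u m else u k) -
        Real.exp (2 * (s.re * C)) / (1 - Real.exp (-(s.re * δ))) * expMass s.re) ≤
      ∏ k ∈ t.erase m, ‖cexp (s * u m) - cexp (s * u k)‖ := by
  refine le_trans ?_ (Finset.prod_le_prod (fun _ _ => (Real.exp_pos _).le)
    fun k hk => le_norm_exp_sub_exp hs hδ hu hsep (Finset.ne_of_mem_erase hk))
  rw [← Real.exp_sum, Finset.sum_sub_distrib, ← Finset.mul_sum, ← Finset.mul_sum]
  have hq : Real.exp (-(s.re * δ)) < 1 := Real.exp_lt_one_iff.mpr (by nlinarith)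
  have h1 : 0 ≤ Real.exp (2 * (s.re * C)) / (1 - Real.exp (-(s.re * δ))) :=
    div_nonneg (Real.exp_pos _).le (by linarith)
  gcongr
  exact sum_exp_neg_mul_abs_sub_le hs m _

/-- A `δ`-separated perturbation of the integers at distance at most `C`, for which the partial
sums of the deviations from the integers grow with slope at most `η`. -/
structure IsNearInt (C δ η : ℝ) (lam : ℤ → ℝ) : Prop where
  near : ∀ k, |lam k - k| ≤ C
  sep : ∀ k m, k ≠ m → δ ≤ |lam k - lam m|
  potential : ∃ U : ℤ → ℝ, (∀ k, U (k + 1) - U k = lam k - k) ∧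
    ∀ m n : ℤ, |U m - U n| ≤ C + η * |(m : ℝ) - n|

/-- Entries of the inverse of the section over `J` of the matrix `(g (lam m - n))`. -/
def sectionInv (a b : ℂ) (lam : ℤ → ℝ) (J : Finset ℤ) (n m : ℤ) : ℂ :=
  cexp (-b * lam m) * cexp (-a * (n : ℝ)) *
    ((∏ j ∈ J.erase n, (cexp ((a + b) * lam m) + cexp ((a + b) * (j : ℝ)))) *
      (-∏ k ∈ J, (-cexp ((a + b) * (n : ℝ)) - cexp ((a + b) * lam k))) /
      ((∏ k ∈ J.erase m, (cexp ((a + b) * lam m) - cexp ((a + b) * lam k))) *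
        ∏ j ∈ J.erase n, (-cexp ((a + b) * (n : ℝ)) + cexp ((a + b) * (j : ℝ)))))

/-- Bound for the entries of the inverses of the finite sections. -/
def sectionBound (σ C δ : ℝ) : ℝ :=
  Real.exp (2 * (Real.exp (2 * (σ * C)) * expMass σ) +
    2 * (Real.exp (2 * (σ * C)) / (1 - Real.exp (-(σ * δ))) * expMass σ) + 2 * (σ * C))

lemma one_le_abs_intCast_sub {k m : ℤ} (h : k ≠ m) : (1 : ℝ) ≤ |(k : ℝ) - m| := by
  have : (1 : ℤ) ≤ |k - m| := Int.one_le_abs (sub_ne_zero.mpr h)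
  exact_mod_cast this

lemma norm_sectionInv_le {a b : ℂ} (ha : 0 < a.re) (hb : 0 < b.re) {C δ η ε : ℝ} (hδ : 0 < δ)
    (hδ1 : δ ≤ 1) (hεa : ε ≤ a.re) (hεb : ε ≤ b.re) (hη : (a + b).re * η ≤ ε / 2)
    {lam : ℤ → ℝ} (hlam : IsNearInt C δ η lam) {p q n m : ℤ}
    (hn : n ∈ Finset.Ico p q) (hm : m ∈ Finset.Ico p q) :
    ‖sectionInv a b lam (Finset.Ico p q) n m‖ ≤
      sectionBound (a + b).re C δ * Real.exp (-(ε / 2) * |(n : ℝ) - m|) := by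
  obtain ⟨U, hU, hUb⟩ := hlam.potential
  set s := a + b with hs_def
  have hs : 0 < s.re := by simp [hs_def]; linarith
  have hsre : s.re = a.re + b.re := by simp [hs_def]
  have hC : 0 ≤ C := (abs_nonneg _).trans (hlam.near 0)
  have hid : ∀ k : ℤ, |((k : ℤ) : ℝ) - k| ≤ C := fun k => by simpa using hC
  have hidsep : ∀ k m : ℤ, k ≠ m → δ ≤ |(k : ℝ) - m| := fun k m h =>
    hδ1.trans (one_le_abs_intCast_sub h)
  set J := Finset.Ico p q
  have hX := prod_norm_exp_add_exp_le hs hlam.near hid m (J.erase n)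
  have hY := prod_norm_exp_add_exp_le hs hid hlam.near n J
  have hV := le_prod_norm_exp_sub_exp hs hδ hlam.near hlam.sep m J
  have hW := le_prod_norm_exp_sub_exp hs hδ hid hidsep n J
  set X := ∏ j ∈ J.erase n, ‖cexp (s * lam m) + cexp (s * (j : ℝ))‖
  set Y := ∏ k ∈ J, ‖cexp (s * (n : ℝ)) + cexp (s * lam k)‖
  set V := ∏ k ∈ J.erase m, ‖cexp (s * lam m) - cexp (s * lam k)‖
  set W := ∏ j ∈ J.erase n, ‖cexp (s * (n : ℝ)) - cexp (s * (j : ℝ))‖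
  have hnorm : ‖sectionInv a b lam J n m‖ =
      Real.exp (-b.re * lam m) * Real.exp (-a.re * n) * (X * Y / (V * W)) := by
    have h1 : ∀ k, ‖-cexp (s * (n : ℝ)) - cexp (s * lam k)‖ =
        ‖cexp (s * (n : ℝ)) + cexp (s * lam k)‖ := fun k => by
      rw [← norm_neg]; congr 1; ring
    have h2 : ∀ j : ℤ, ‖-cexp (s * (n : ℝ)) + cexp (s * (j : ℝ))‖ =
        ‖cexp (s * (n : ℝ)) - cexp (s * (j : ℝ))‖ := fun k => by
      rw [← norm_neg]; congr 1; ring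
    simp only [sectionInv, norm_mul, norm_div, norm_neg, norm_prod, norm_exp_mul_ofReal,
      ← hs_def, h1, h2, Complex.neg_re, X, Y, V, W]
  set c₁ := Real.exp (2 * (s.re * C)) * expMass s.re
  set c₂ := Real.exp (2 * (s.re * C)) / (1 - Real.exp (-(s.re * δ))) * expMass s.re
  have hfrac : X * Y / (V * W) ≤
      Real.exp (s.re * (U (m + 1) - U (n + 1) + lam m + n - (if n ≤ m then lam m else (n : ℝ))) +
        2 * c₁ + 2 * c₂) := by
    have hXY := mul_le_mul hX hY (Finset.prod_nonneg fun _ _ => norm_nonneg _) (Real.exp_pos _).le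
    have hVW := mul_le_mul hV hW (Real.exp_pos _).le (Finset.prod_nonneg fun _ _ => norm_nonneg _)
    refine (div_le_div₀ (by positivity) hXY (by positivity) hVW).trans (le_of_eq ?_)
    rw [← Real.exp_add, ← Real.exp_add, ← Real.exp_sub]
    congr 1
    have e1 := Finset.add_sum_erase J (fun j : ℤ => if j ≤ m then lam m else (j : ℝ)) hn
    have e2 := Finset.add_sum_erase J (fun k : ℤ => if k ≤ m then lam m else lam k) hm
    have e3 := Finset.add_sum_erase J (fun j : ℤ => if j ≤ n then (n : ℝ) else (j : ℝ)) hn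
    have e4 := sum_Ico_int_ite hU hm
    have e5 := sum_Ico_int_ite hU hn
    have e6 :
        ∑ j ∈ J, (if j ≤ m then lam m else lam j) - ∑ j ∈ J, (if j ≤ m then lam m else (j : ℝ))
        = ∑ k ∈ J, (if k ≤ m then 0 else lam k - k) := by
      rw [← Finset.sum_sub_distrib]
      exact Finset.sum_congr rfl fun k _ => by split_ifs <;> ring
    have e7 :
        ∑ j ∈ J, (if j ≤ n then (n : ℝ) else lam j) - ∑ j ∈ J, (if j ≤ n then (n : ℝ) else (j : ℝ))
        = ∑ k ∈ J, (if k ≤ n then 0 else lam k - k) := by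
      rw [← Finset.sum_sub_distrib]
      exact Finset.sum_congr rfl fun k _ => by split_ifs <;> ring
    simp only [le_refl, if_true] at e1 e2 e3
    rw [e4] at e6
    rw [e5] at e7
    linear_combination s.re * (e1 - e2 - e3 - e6 + e7)
  rw [hnorm, sectionBound, ← Real.exp_add, ← Real.exp_add]
  refine (mul_le_mul_of_nonneg_left hfrac (Real.exp_pos _).le).trans ?_
  rw [← Real.exp_add]
  refine Real.exp_le_exp.mpr ?_
  have hUb' : s.re * (U (m + 1) - U (n + 1)) ≤ s.re * C + ε / 2 * |(n : ℝ) - m| := by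
    have h1 := (le_abs_self _).trans (hUb (m + 1) (n + 1))
    have h2 : |((m + 1 : ℤ) : ℝ) - ((n + 1 : ℤ) : ℝ)| = |(n : ℝ) - m| := by
      rw [abs_sub_comm]; push_cast; congr 1; ring
    rw [h2] at h1
    calc s.re * (U (m + 1) - U (n + 1)) ≤ s.re * (C + η * |(n : ℝ) - m|) :=
          mul_le_mul_of_nonneg_left h1 hs.le
      _ = s.re * C + (s.re * η) * |(n : ℝ) - m| := by ring
      _ ≤ _ := by gcongr
  have hmain : -b.re * lam m + -a.re * n + s.re * (lam m + n - (if n ≤ m then lam m else (n : ℝ))) ≤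
      s.re * C - ε * |(n : ℝ) - m| := by
    have hnear := abs_le.mp (hlam.near m)
    rw [hsre]
    split_ifs with h
    · have h' : (n : ℝ) ≤ m := by exact_mod_cast h
      rw [abs_of_nonpos (sub_nonpos.mpr h')]
      nlinarith
    · have h' : (m : ℝ) ≤ n := by exact_mod_cast (not_le.mp h).le
      rw [abs_of_nonneg (sub_nonneg.mpr h')]
      nlinarith
  linarith

lemma exp_add_exp_ne_zero {s : ℂ} (hs : 0 < s.re) (x y : ℝ) :
    cexp (s * x) + cexp (s * y) ≠ 0 := by
  intro h
  have h1 : cexp (s * x) = -cexp (s * y) := eq_neg_of_add_eq_zero_left h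
  have h2 : ‖cexp (s * x)‖ = ‖cexp (s * y)‖ := by rw [h1, norm_neg]
  rw [norm_exp_mul_ofReal, norm_exp_mul_ofReal] at h2
  have h3 : x = y := mul_left_cancel₀ hs.ne' (Real.exp_injective h2)
  subst h3
  rw [← two_mul] at h
  simp at h

lemma injective_exp_mul_ofReal {s : ℂ} (hs : 0 < s.re) :
    Function.Injective fun x : ℝ => cexp (s * x) := by
  intro x y h
  have h2 : ‖cexp (s * x)‖ = ‖cexp (s * y)‖ := congrArg _ h
  rw [norm_exp_mul_ofReal, norm_exp_mul_ofReal] at h2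
  exact mul_left_cancel₀ hs.ne' (Real.exp_injective h2)

/-- The generator `1 / (e^{ax} + e^{-bx})`. -/
def sechGen (a b : ℂ) (x : ℝ) : ℂ := 1 / (cexp (a * x) + cexp (-b * x))

lemma sechGen_sub (a b : ℂ) (x y : ℝ) :
    sechGen a b (x - y) =
      cexp (b * x) * cexp (a * y) * (cexp ((a + b) * x) + cexp ((a + b) * y))⁻¹ := by
  have h : cexp ((a + b) * x) + cexp ((a + b) * y) =
      cexp (b * x) * cexp (a * y) *
        (cexp (a * ((x - y : ℝ) : ℂ)) + cexp (-b * ((x - y : ℝ) : ℂ))) := by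
    rw [mul_add, ← Complex.exp_add, ← Complex.exp_add, ← Complex.exp_add]
    push_cast
    ring_nf
  rw [h, mul_inv, ← mul_assoc, mul_inv_cancel₀, one_mul, sechGen, one_div]
  exact mul_ne_zero (Complex.exp_ne_zero _) (Complex.exp_ne_zero _)

lemma sechGen_denom_ne_zero {a b : ℂ} (hs : 0 < (a + b).re) (x : ℝ) :
    cexp (a * x) + cexp (-b * x) ≠ 0 := by
  have h : cexp (a * x) + cexp (-b * x) =
      cexp (-b * x) * (cexp ((a + b) * x) + cexp ((a + b) * (0 : ℝ))) := by
    rw [mul_add, ← Complex.exp_add, ← Complex.exp_add]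
    push_cast
    ring_nf
  rw [h]
  exact mul_ne_zero (Complex.exp_ne_zero _) (exp_add_exp_ne_zero hs _ _)

lemma continuous_sechGen {a b : ℂ} (hs : 0 < (a + b).re) : Continuous (sechGen a b) := by
  unfold sechGen
  exact continuous_const.div (by fun_prop) (sechGen_denom_ne_zero hs)

lemma exists_norm_sechGen_le {a b : ℂ} {ε : ℝ} (hε : 0 < ε) (hεa : ε ≤ a.re) (hεb : ε ≤ b.re) :
    ∃ D : ℝ, 0 < D ∧ ∀ x, ‖sechGen a b x‖ ≤ D * Real.exp (-ε * |x|) := by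
  have hs : 0 < (a + b).re := by simp; linarith
  obtain ⟨B, hB⟩ := (isCompact_Icc (a := (-1 : ℝ)) (b := 1)).exists_bound_of_continuousOn
    (continuous_sechGen hs).continuousOn
  have hB0 : 0 ≤ B := (norm_nonneg _).trans (hB 0 (by simp))
  set σ := a.re + b.re with hσ
  set r := 1 - Real.exp (-σ)
  have hr : 0 < r := sub_pos.mpr (Real.exp_lt_one_iff.mpr (by linarith))
  refine ⟨B * Real.exp ε + r⁻¹, by positivity, fun x => ?_⟩
  rcases le_or_gt |x| 1 with hx | hx
  · have h1 : B ≤ B * Real.exp ε * Real.exp (-ε * |x|) := by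
      rw [mul_assoc, ← Real.exp_add]
      exact le_mul_of_one_le_right hB0 (Real.one_le_exp (by nlinarith))
    rw [add_mul]
    exact (hB x (abs_le.mp hx)).trans (h1.trans (le_add_of_nonneg_right (by positivity)))
  · have hden : Real.exp (ε * |x|) * r ≤ ‖cexp (a * x) + cexp (-b * x)‖ := by
      have h0 : |Real.exp (a.re * x) - Real.exp (-b.re * x)| ≤
          ‖cexp (a * x) + cexp (-b * x)‖ := by
        have := abs_norm_sub_norm_le (cexp (a * x)) (-cexp (-b * x))
        rwa [norm_neg, sub_neg_eq_add, norm_exp_mul_ofReal, norm_exp_mul_ofReal,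
          Complex.neg_re] at this
      refine le_trans ?_ h0
      have habs : |a.re * x - -b.re * x| = σ * |x| := by
        rw [← sub_mul, abs_mul, sub_neg_eq_add, abs_of_pos (by linarith)]
      have hr' : r ≤ 1 - Real.exp (-(σ * |x|)) :=
        sub_le_sub_left (Real.exp_le_exp.mpr (by nlinarith)) 1
      rcases le_total 0 x with h | h
      · have := exp_mul_one_sub_le_abs (a.re * x) (-b.re * x)
        rw [habs] at this
        refine le_trans ?_ this
        rw [abs_of_nonneg h] at hr' ⊢
        gcongr
      · have := exp_mul_one_sub_le_abs (-b.re * x) (a.re * x)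
        rw [abs_sub_comm, habs, abs_sub_comm (Real.exp _)] at this
        refine le_trans ?_ this
        rw [abs_of_nonpos h] at hr' ⊢
        exact mul_le_mul (Real.exp_le_exp.mpr (by nlinarith)) hr' hr.le (Real.exp_pos _).le
    rw [sechGen, norm_div, norm_one, add_mul]
    refine le_trans ?_ (le_add_of_nonneg_left (by positivity))
    rw [neg_mul ε, Real.exp_neg, ← mul_inv, mul_comm r, one_div]
    exact inv_anti₀ (by positivity) hden

lemma norm_sechGen_sub_le {a b : ℂ} {ε D C : ℝ} (hε : 0 < ε) (hD : 0 < D)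
    (h : ∀ x, ‖sechGen a b x‖ ≤ D * Real.exp (-ε * |x|)) {lam : ℤ → ℝ}
    (hlam : ∀ k, |lam k - k| ≤ C) (m n : ℤ) :
    ‖sechGen a b (lam m - n)‖ ≤ D * Real.exp (ε * C) * Real.exp (-ε * |(m : ℝ) - n|) := by
  refine (h _).trans ?_
  rw [mul_assoc, ← Real.exp_add]
  gcongr
  have h1 : |(m : ℝ) - n| ≤ |lam m - n| + C := by
    have := abs_sub_le (m : ℝ) (lam m) n
    have := hlam m
    rw [abs_sub_comm] at this
    linarith
  nlinarith

lemma sum_sectionInv_mul {a b : ℂ} (hs : 0 < (a + b).re) {lam : ℤ → ℝ}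
    (hinj : Function.Injective lam) {J : Finset ℤ} {n n' : ℤ} (hn : n ∈ J) (hn' : n' ∈ J) :
    ∑ m ∈ J, sectionInv a b lam J n m * sechGen a b (lam m - n') = if n = n' then 1 else 0 := by
  have key := cauchy_left_inverse J (fun m => cexp ((a + b) * lam m))
    (fun n : ℤ => cexp ((a + b) * (n : ℝ)))
    (((injective_exp_mul_ofReal hs).comp hinj).injOn)
    (((injective_exp_mul_ofReal hs).comp Int.cast_injective).injOn)
    (fun m _ n _ => exp_add_exp_ne_zero hs _ _) hn hn'
  have hterm : ∀ m ∈ J, sectionInv a b lam J n m * sechGen a b (lam m - n') =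
      cexp (-a * (n : ℝ)) * cexp (a * (n' : ℝ)) *
      (((∏ j ∈ J.erase n, (cexp ((a + b) * lam m) + cexp ((a + b) * (j : ℝ)))) *
      (-∏ k ∈ J, (-cexp ((a + b) * (n : ℝ)) - cexp ((a + b) * lam k))) /
      ((∏ k ∈ J.erase m, (cexp ((a + b) * lam m) - cexp ((a + b) * lam k))) *
        ∏ j ∈ J.erase n, (-cexp ((a + b) * (n : ℝ)) + cexp ((a + b) * (j : ℝ))))) *
        (cexp ((a + b) * lam m) + cexp ((a + b) * (n' : ℝ)))⁻¹) := by
    intro m _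
    have h1 : cexp (-b * lam m) * cexp (b * lam m) = 1 := by
      rw [← Complex.exp_add]
      simp
    rw [sechGen_sub, sectionInv]
    linear_combination (cexp (-a * (n : ℝ)) * cexp (a * (n' : ℝ)) *
      (((∏ j ∈ J.erase n, (cexp ((a + b) * lam m) + cexp ((a + b) * (j : ℝ)))) *
      (-∏ k ∈ J, (-cexp ((a + b) * (n : ℝ)) - cexp ((a + b) * lam k))) /
      ((∏ k ∈ J.erase m, (cexp ((a + b) * lam m) - cexp ((a + b) * lam k))) *
        ∏ j ∈ J.erase n, (-cexp ((a + b) * (n : ℝ)) + cexp ((a + b) * (j : ℝ))))) *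
        (cexp ((a + b) * lam m) + cexp ((a + b) * (n' : ℝ)))⁻¹)) * h1
  rw [Finset.sum_congr rfl hterm, ← Finset.mul_sum, key]
  split_ifs with h
  · subst h
    rw [← Complex.exp_add]
    simp
  · simp

lemma sum_mul_sectionInv {a b : ℂ} (hs : 0 < (a + b).re) {lam : ℤ → ℝ}
    (hinj : Function.Injective lam) {J : Finset ℤ} {m m' : ℤ} (hm : m ∈ J) (hm' : m' ∈ J) :
    ∑ n ∈ J, sechGen a b (lam m - n) * sectionInv a b lam J n m' = if m = m' then 1 else 0 := by
  let A : Matrix J J ℂ := fun n m => sectionInv a b lam J n m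
  let B : Matrix J J ℂ := fun m n => sechGen a b (lam m - (n : ℤ))
  have hAB : A * B = 1 := by
    ext n n'
    rw [Matrix.mul_apply, Matrix.one_apply]
    have := sum_sectionInv_mul hs hinj n.2 n'.2
    rw [← Finset.sum_coe_sort] at this
    simp only [Subtype.ext_iff]
    exact this
  have hBA' : B * A = 1 := mul_eq_one_comm.mp hAB
  have hBA := congrFun (congrFun hBA' ⟨m, hm⟩) ⟨m', hm'⟩
  rw [Matrix.mul_apply, Matrix.one_apply] at hBA
  rw [← Finset.sum_coe_sort]
  simp only [Subtype.mk.injEq] at hBA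
  exact hBA

/-- The matrix `(g (lam m - n))` has a two-sided inverse with exponential off-diagonal decay,
with constants uniform over the class of near-integer sequences. -/
lemma exists_inverse {a b : ℂ} (ha : 0 < a.re) (hb : 0 < b.re) {C δ η ε : ℝ} (hε : 0 < ε)
    (hδ : 0 < δ) (hδ1 : δ ≤ 1) (hεa : ε ≤ a.re) (hεb : ε ≤ b.re)
    (hη : (a + b).re * η ≤ ε / 2) {lam : ℤ → ℝ} (hlam : IsNearInt C δ η lam) :
    ∃ K : ℤ → ℤ → ℂ,
      (∀ n m, ‖K n m‖ ≤ sectionBound (a + b).re C δ * Real.exp (-(ε / 2) * |(n : ℝ) - m|)) ∧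
      (∀ n n' : ℤ, ∑' m, K n m * sechGen a b (lam m - n') = if n = n' then 1 else 0) ∧
      (∀ m m' : ℤ, ∑' n : ℤ, sechGen a b (lam m - n) * K n m' = if m = m' then 1 else 0) := by
  have hs : 0 < (a + b).re := by simp; linarith
  have hinj : Function.Injective lam := fun k m h => by
    by_contra hne
    have := hlam.sep k m hne
    rw [h, sub_self, abs_zero] at this
    linarith
  obtain ⟨D, hD, hg⟩ := exists_norm_sechGen_le hε hεa hεb
  have hgl := norm_sechGen_sub_le hε hD hg hlam.near
  set S := sectionBound (a + b).re C δ with hSdef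
  have hS : 0 < S := Real.exp_pos _
  let J : ℕ → Finset ℤ := fun H => Finset.Ico (-(H : ℤ)) H
  let κ : ℕ → ℤ → ℤ → ℂ := fun H n m =>
    if n ∈ J H ∧ m ∈ J H then sectionInv a b lam (J H) n m else 0
  have hκ : ∀ H n m, ‖κ H n m‖ ≤ S * Real.exp (-(ε / 2) * |(n : ℝ) - m|) := by
    intro H n m
    simp only [κ]
    split_ifs with h
    · exact norm_sectionInv_le ha hb hδ hδ1 hεa hεb hη hlam h.1 h.2
    · simpa using mul_nonneg hS.le (Real.exp_pos _).le
  let F : Ultrafilter ℕ := hyperfilter ℕ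
  have hF : (F : Filter ℕ) ≤ atTop := Nat.hyperfilter_le_atTop
  have hlim : ∀ n m, ∃ L, Tendsto (fun H => κ H n m) F (nhds L) := by
    intro n m
    have hcomp := isCompact_closedBall (0 : ℂ) (S * Real.exp (-(ε / 2) * |(n : ℝ) - m|))
    obtain ⟨L, -, hL⟩ := hcomp.ultrafilter_le_nhds' (F.map fun H => κ H n m)
      (Ultrafilter.mem_map.mpr (Filter.univ_mem' fun H => by simpa using hκ H n m))
    exact ⟨L, hL⟩
  choose K hK using hlim
  have hmem : ∀ n : ℤ, ∀ᶠ H in (F : Filter ℕ), n ∈ J H := by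
    intro n
    refine hF.trans le_rfl (eventually_atTop.mpr ⟨n.natAbs + 1, fun H hH => ?_⟩)
    simp only [J, Finset.mem_Ico]
    omega
  refine ⟨K, fun n m => le_of_tendsto (hK n m).norm (Filter.Eventually.of_forall fun H => hκ H n m),
    fun n n' => ?_, fun m m' => ?_⟩
  · have h1 : Tendsto (fun H => ∑' m, κ H n m * sechGen a b (lam m - n')) F
        (nhds (∑' m, K n m * sechGen a b (lam m - n'))) := by
      refine tendsto_tsum_of_dominated_convergence
        (bound := fun m : ℤ => S * Real.exp (-(ε / 2) * |(n : ℝ) - m|) * (D * Real.exp (ε * C)))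
        (((summable_exp_neg_mul_abs_sub (half_pos hε) n).mul_left S).mul_right _)
        (fun m => (hK n m).mul_const _) (Filter.Eventually.of_forall fun H m => ?_)
      rw [norm_mul]
      refine mul_le_mul (hκ H n m) ((hgl m n').trans ?_) (norm_nonneg _) (by positivity)
      exact mul_le_of_le_one_right (by positivity)
        (Real.exp_le_one_iff.mpr (by nlinarith [abs_nonneg ((m : ℝ) - n')]))
    refine tendsto_nhds_unique (h1.congr' ?_) tendsto_const_nhds
    filter_upwards [hmem n, hmem n'] with H hn hn'
    rw [tsum_eq_sum (s := J H) (fun m hm => by simp [κ, hm]), ← sum_sectionInv_mul hs hinj hn hn']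
    exact Finset.sum_congr rfl fun m hm => by simp [κ, hm, hn]
  · have h1 : Tendsto (fun H => ∑' n : ℤ, sechGen a b (lam m - n) * κ H n m') F
        (nhds (∑' n : ℤ, sechGen a b (lam m - n) * K n m')) := by
      refine tendsto_tsum_of_dominated_convergence
        (bound := fun n : ℤ => D * Real.exp (ε * C) * Real.exp (-ε * |(m : ℝ) - n|) * S)
        (((summable_exp_neg_mul_abs_sub hε m).mul_left _).mul_right _)
        (fun n => (hK n m').const_mul _) (Filter.Eventually.of_forall fun H n => ?_)
      rw [norm_mul]
      refine mul_le_mul (hgl m n) ((hκ H n m').trans ?_) (norm_nonneg _) (by positivity)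
      exact mul_le_of_le_one_right hS.le
        (Real.exp_le_one_iff.mpr (by nlinarith [abs_nonneg ((n : ℝ) - m')]))
    refine tendsto_nhds_unique (h1.congr' ?_) tendsto_const_nhds
    filter_upwards [hmem m, hmem m'] with H hm hm'
    rw [tsum_eq_sum (s := J H) (fun n hn => by simp [κ, hn]), ← sum_mul_sectionInv hs hinj hm hm']
    exact Finset.sum_congr rfl fun n hn => by simp [κ, hn, hm']

lemma exists_bounded_walk_nat {L R : ℕ → ℝ} {M : ℝ} (hL : ∀ k, -M ≤ L k ∧ L k ≤ 0)
    (hR : ∀ k, 0 ≤ R k ∧ R k ≤ M) :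
    ∃ T : ℕ → ℝ, T 0 = 0 ∧ (∀ k, |T k| ≤ M) ∧
      ∀ k, T (k + 1) - T k = L k ∨ T (k + 1) - T k = R k := by
  let T : ℕ → ℝ := fun n =>
    Nat.rec (motive := fun _ => ℝ) 0 (fun k x => x + if 0 ≤ x then L k else R k) n
  have hT : ∀ k : ℕ, T (k + 1) = T k + if 0 ≤ T k then L k else R k := fun _ => rfl
  refine ⟨T, rfl, fun k => ?_, fun k => ?_⟩
  · induction k with
    | zero =>
      have := hL 0
      simpa [T] using (by linarith : 0 ≤ M)
    | succ k ih =>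
      have hLk := hL k
      have hRk := hR k
      rw [abs_le] at ih ⊢
      rw [hT]
      split_ifs with h <;> constructor <;> linarith
  · rw [hT]
    split_ifs
    · exact Or.inl (by ring)
    · exact Or.inr (by ring)

/-- A walk on `ℤ` whose steps may be chosen nonpositive or nonnegative can be kept bounded. -/
lemma exists_bounded_walk {L R : ℤ → ℝ} {M : ℝ} (hL : ∀ k, -M ≤ L k ∧ L k ≤ 0)
    (hR : ∀ k, 0 ≤ R k ∧ R k ≤ M) :
    ∃ T : ℤ → ℝ, (∀ k, |T k| ≤ M) ∧ ∀ k, T (k + 1) - T k = L k ∨ T (k + 1) - T k = R k := by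
  obtain ⟨f, hf0, hfM, hf⟩ := exists_bounded_walk_nat (L := fun k : ℕ => L k)
    (R := fun k : ℕ => R k) (fun k => hL k) (fun k => hR k)
  obtain ⟨h, hh0, hhM, hh⟩ := exists_bounded_walk_nat (L := fun k : ℕ => -R (Int.negSucc k))
    (R := fun k : ℕ => -L (Int.negSucc k)) (M := M)
    (fun k => by have := hR (Int.negSucc k); constructor <;> linarith)
    (fun k => by have := hL (Int.negSucc k); constructor <;> linarith)
  let T : ℤ → ℝ := fun k => match k with
    | Int.ofNat n => f n
    | Int.negSucc n => h (n + 1)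
  refine ⟨T, fun k => ?_, fun k => ?_⟩
  · cases k with
    | ofNat n => exact hfM n
    | negSucc n => exact hhM (n + 1)
  · cases k with
    | ofNat n => exact hf n
    | negSucc n =>
      have h1 : T (Int.negSucc n + 1) = h n := by
        cases n with
        | zero => exact hf0.trans hh0.symm
        | succ n => rfl
      have h2 : T (Int.negSucc n) = h (n + 1) := rfl
      rw [h1, h2]
      rcases hh n with h3 | h3
      · exact Or.inr (by linarith)
      · exact Or.inl (by linarith)

/-- Lower density larger than one gives, for some length `r`, at least `r + 2` points in every
interval `[i r, (i + 1) r)`. -/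
lemma exists_points_of_lowerDensity {Λ : Set ℝ} (hd : 1 < lowerDensity Λ) :
    ∃ r : ℕ, 1 ≤ r ∧ ∃ p : ℤ → ℕ → ℝ, ∀ i : ℤ,
      (∀ t < r + 2, p i t ∈ Λ ∧ (i : ℝ) * r ≤ p i t ∧ p i t < ((i : ℝ) + 1) * r) ∧
      ∀ t < r + 2, ∀ t' < r + 2, p i t = p i t' → t = t' := by
  obtain ⟨d, hd1, hd2⟩ := exists_between hd
  have hbd : ∀ r : ℝ, 0 < r → BddBelow (Set.range fun x : ℝ =>
      ((Λ ∩ Set.Icc x (x + r)).ncard : ℝ) / r) := fun r hr =>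
    ⟨0, by rintro _ ⟨x, rfl⟩; positivity⟩
  have hev : ∀ᶠ r : ℝ in atTop, d < ⨅ x : ℝ, ((Λ ∩ Set.Icc x (x + r)).ncard : ℝ) / r := by
    refine eventually_lt_of_lt_liminf hd2 ⟨0, ?_⟩
    rw [eventually_map]
    filter_upwards [eventually_gt_atTop 0] with r hr
    exact Real.iInf_nonneg fun x => by positivity
  have hev' : ∀ᶠ r : ℕ in atTop, d < ⨅ x : ℝ,
      ((Λ ∩ Set.Icc x (x + ((r : ℝ) - 1 / 2))).ncard : ℝ) / ((r : ℝ) - 1 / 2) :=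
    (tendsto_atTop_add_const_right _ (-(1 / 2 : ℝ)) tendsto_natCast_atTop_atTop).eventually hev
  obtain ⟨r₀, hr₀⟩ := exists_nat_gt ((2 + d / 2) / (d - 1))
  obtain ⟨r, hr, hr1, hrr⟩ := (hev'.and ((eventually_ge_atTop 1).and
    (eventually_ge_atTop r₀))).exists
  have hr1' : (1 : ℝ) ≤ r := by exact_mod_cast hr1
  have hpos : (0 : ℝ) < (r : ℝ) - 1 / 2 := by linarith
  have hlarge : (r : ℝ) + 2 ≤ d * ((r : ℝ) - 1 / 2) := by
    have h1 : (2 + d / 2) / (d - 1) < r := hr₀.trans_le (by exact_mod_cast hrr)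
    rw [div_lt_iff₀ (by linarith)] at h1
    linarith
  refine ⟨r, hr1, ?_⟩
  have hpts : ∀ i : ℤ, ∃ p : ℕ → ℝ,
      (∀ t < r + 2, p t ∈ Λ ∧ (i : ℝ) * r ≤ p t ∧ p t < ((i : ℝ) + 1) * r) ∧
      ∀ t < r + 2, ∀ t' < r + 2, p t = p t' → t = t' := by
    intro i
    set A := Λ ∩ Set.Icc ((i : ℝ) * r) ((i : ℝ) * r + ((r : ℝ) - 1 / 2))
    have hA : r + 2 ≤ A.ncard := by
      have h1 := hr.trans_le (ciInf_le (hbd _ hpos) ((i : ℝ) * r))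
      rw [lt_div_iff₀ hpos] at h1
      have h2 : ((r + 2 : ℕ) : ℝ) ≤ A.ncard := by push_cast; linarith
      exact_mod_cast h2
    have hfin : A.Finite := Set.finite_of_ncard_pos (by omega)
    obtain ⟨B, hBA, hB⟩ := Set.exists_subset_card_eq hA
    have hBfin : B.Finite := hfin.subset hBA
    let e := (hBfin.toFinset.orderIsoOfFin
      (k := r + 2) (by rw [← Set.ncard_eq_toFinset_card _ hBfin, hB]))
    refine ⟨fun t => if ht : t < r + 2 then e ⟨t, ht⟩ else 0, fun t ht => ?_,
      fun t ht t' ht' h => ?_⟩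
    · have hmem : (e ⟨t, ht⟩ : ℝ) ∈ A := hBA (hBfin.mem_toFinset.mp (e ⟨t, ht⟩).2)
      simp only [ht, dif_pos]
      exact ⟨hmem.1, hmem.2.1, by linarith [hmem.2.2]⟩
    · simp only [ht, ht', dif_pos] at h
      simpa using e.injective (Subtype.ext h)
  choose p hp using hpts
  exact ⟨p, hp⟩

lemma sum_range_mul_div_add_mod (A w : ℕ) (hw : 0 < w) :
    ∑ j ∈ Finset.range (A * w), (2 * ((j / w : ℕ) : ℝ) + ((j % w : ℕ) : ℝ)) =
      w * (A * (A - 1)) + A * (w * (w - 1) / 2) := by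
  have hid : ∀ n : ℕ, ∑ t ∈ Finset.range n, (t : ℝ) = n * (n - 1) / 2 := by
    intro n
    induction n with
    | zero => simp
    | succ n ih =>
      rw [Finset.sum_range_succ, ih]
      push_cast
      ring
  induction A with
  | zero => simp
  | succ A ih =>
    rw [Nat.succ_mul, Finset.sum_range_add, ih]
    have h : ∀ t ∈ Finset.range w, (2 * (((A * w + t) / w : ℕ) : ℝ) + (((A * w + t) % w : ℕ) : ℝ)) =
        2 * (A : ℝ) + t := by
      intro t ht
      have ht' := Finset.mem_range.mp ht
      have h1 : (A * w + t) / w = A := by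
        rw [mul_comm, Nat.mul_add_div hw, Nat.div_eq_of_lt ht', add_zero]
      have h2 : (A * w + t) % w = t := by
        rw [mul_comm, Nat.mul_add_mod, Nat.mod_eq_of_lt ht']
      rw [h1, h2]
    rw [Finset.sum_congr rfl h, Finset.sum_add_distrib, hid, Finset.sum_const, Finset.card_range]
    simp only [nsmul_eq_mul]
    push_cast
    ring

lemma int_block_div_mod {N : ℕ} {k : ℤ} {j : ℕ} (hj : j < N) :
    (k * N + j) / (N : ℤ) = k ∧ ((k * N + j) % (N : ℤ)).toNat = j := by
  have hN : (0 : ℤ) < N := by omega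
  have h := (Int.ediv_emod_unique (a := k * N + j) (r := (j : ℤ)) (q := k) hN).mpr
    ⟨by ring, by omega, by omega⟩
  exact ⟨h.1, by rw [h.2]; simp⟩

lemma exists_int_block {N : ℕ} (hN : 0 < N) (n : ℤ) :
    ∃ (k : ℤ) (j : ℕ), j < N ∧ n = k * N + j := by
  have hN' : (0 : ℤ) < N := by omega
  refine ⟨n / N, (n % N).toNat, ?_, ?_⟩
  · have := Int.emod_lt_of_pos n hN'
    have := Int.emod_nonneg n hN'.ne'
    omega
  · rw [Int.toNat_of_nonneg (Int.emod_nonneg n hN'.ne')]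
    exact (Int.ediv_mul_add_emod n N).symm

/-- A separated set of lower density larger than one contains a near-integer sequence whose
deviations from the integers have bounded partial sums. -/
lemma exists_nearInt_of_lowerDensity {Λ : Set ℝ} (hΛ : Separated Λ) (hd : 1 < lowerDensity Λ) :
    ∃ (C δ : ℝ) (lam : ℤ → ℝ), 0 < δ ∧ δ ≤ 1 ∧ (∀ k, lam k ∈ Λ) ∧ IsNearInt C δ 0 lam := by
  obtain ⟨δ, hδ, hsep⟩ := hΛ
  obtain ⟨r, hr, p, hp⟩ := exists_points_of_lowerDensity hd
  set w := r + 2 with hw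
  set N := r * w with hNdef
  have hw0 : 0 < w := by omega
  have hN : 0 < N := by positivity
  have hrR : (1 : ℝ) ≤ r := by exact_mod_cast hr
  -- the `j`-th chosen point in the `k`-th block, with the choice shifted by `s` intervals
  let P : ℤ → ℕ → ℕ → ℝ := fun k s j => p (k * w + (j / w : ℕ) + s) (j % w)
  have hdiv : ∀ j < N, j / w < r := fun j hj => Nat.div_lt_of_lt_mul (by rwa [mul_comm])
  have hmod : ∀ j, j % w < w := fun j => Nat.mod_lt _ hw0
  let D : ℤ → ℕ → ℕ → ℝ := fun k s j => P k s j - ((k * N + j : ℤ) : ℝ)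
  have hD : ∀ (k : ℤ) (s j : ℕ),
      (s : ℝ) * r - (2 * ((j / w : ℕ) : ℝ) + ((j % w : ℕ) : ℝ)) ≤ D k s j ∧
      D k s j ≤ ((s : ℝ) + 1) * r - (2 * ((j / w : ℕ) : ℝ) + ((j % w : ℕ) : ℝ)) := by
    intro k s j
    obtain ⟨h1, h2⟩ : ((k * w + (j / w : ℕ) + s : ℤ) : ℝ) * r ≤ P k s j ∧
        P k s j < (((k * w + (j / w : ℕ) + s : ℤ) : ℝ) + 1) * r :=
      ((hp (k * w + (j / w : ℕ) + s)).1 (j % w) (hmod j)).2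
    have h3 : ((j : ℕ) : ℝ) = w * ((j / w : ℕ) : ℝ) + ((j % w : ℕ) : ℝ) := by
      exact_mod_cast (Nat.div_add_mod j w).symm
    have hwR : (w : ℝ) = r + 2 := by rw [hw]; push_cast; ring
    have hNR : (N : ℝ) = r * w := by rw [hNdef]; push_cast; ring
    have h4 : D k s j = P k s j - ((k * N + j : ℤ) : ℝ) := rfl
    rw [h4]
    generalize P k s j = y at h1 h2 ⊢
    generalize j / w = i at h1 h2 h3 ⊢
    push_cast at h1 h2 ⊢
    rw [h3, hNR, hwR]
    rw [hwR] at h1 h2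
    constructor <;> nlinarith
  set C₀ : ℝ := 3 * r + 2 with hC₀
  have hC₀0 : 0 ≤ C₀ := by positivity
  have hDC : ∀ k s j, s ≤ 2 → j < N → |D k s j| ≤ C₀ := by
    intro k s j hs hj
    have h1 := hD k s j
    have hi : ((j / w : ℕ) : ℝ) + 1 ≤ r := by exact_mod_cast hdiv j hj
    have ht : ((j % w : ℕ) : ℝ) ≤ r + 2 := by exact_mod_cast (hmod j).le
    have hi0 : (0 : ℝ) ≤ ((j / w : ℕ) : ℝ) := Nat.cast_nonneg _
    have ht0 : (0 : ℝ) ≤ ((j % w : ℕ) : ℝ) := Nat.cast_nonneg _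
    have hs' : (s : ℝ) ≤ 2 := by exact_mod_cast hs
    have hs0 : (0 : ℝ) ≤ s := Nat.cast_nonneg _
    rw [abs_le]
    constructor <;> nlinarith
  have hpart : ∀ k s j, s ≤ 2 → j ≤ N → |∑ i ∈ Finset.range j, D k s i| ≤ N * C₀ := by
    intro k s j hs hj
    refine (Finset.abs_sum_le_sum_abs _ _).trans ?_
    refine (Finset.sum_le_card_nsmul _ _ C₀ fun i hi =>
      hDC k s i hs ((Finset.mem_range.mp hi).trans_le hj)).trans ?_
    rw [Finset.card_range, nsmul_eq_mul]
    have : (j : ℝ) ≤ N := by exact_mod_cast hj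
    gcongr
  have hgauss := sum_range_mul_div_add_mod r w hw0
  rw [← hNdef] at hgauss
  have hwR : (w : ℝ) = r + 2 := by rw [hw]; push_cast; ring
  have hNR : (N : ℝ) = r * w := by rw [hNdef]; push_cast; ring
  have hL : ∀ k, ∑ j ∈ Finset.range N, D k 0 j ≤ 0 := by
    intro k
    have h1 : ∑ j ∈ Finset.range N, D k 0 j ≤ ∑ j ∈ Finset.range N,
        ((r : ℝ) - (2 * ((j / w : ℕ) : ℝ) + ((j % w : ℕ) : ℝ))) :=
      Finset.sum_le_sum fun j _ => by simpa using (hD k 0 j).2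
    refine h1.trans ?_
    rw [Finset.sum_sub_distrib, hgauss, Finset.sum_const, Finset.card_range, nsmul_eq_mul, hNR,
      hwR]
    nlinarith [mul_nonneg (mul_nonneg (by linarith : (0 : ℝ) ≤ r) (by linarith : (0 : ℝ) ≤ r + 2))
      (by linarith : (0 : ℝ) ≤ r - 1)]
  have hR : ∀ k, 0 ≤ ∑ j ∈ Finset.range N, D k 2 j := by
    intro k
    have h1 : ∑ j ∈ Finset.range N,
        (2 * (r : ℝ) - (2 * ((j / w : ℕ) : ℝ) + ((j % w : ℕ) : ℝ))) ≤
        ∑ j ∈ Finset.range N, D k 2 j :=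
      Finset.sum_le_sum fun j _ => by simpa using (hD k 2 j).1
    refine le_trans ?_ h1
    rw [Finset.sum_sub_distrib, hgauss, Finset.sum_const, Finset.card_range, nsmul_eq_mul, hNR,
      hwR]
    nlinarith [mul_nonneg (by linarith : (0 : ℝ) ≤ r) (by linarith : (0 : ℝ) ≤ r + 2),
      mul_nonneg (mul_nonneg (by linarith : (0 : ℝ) ≤ r) (by linarith : (0 : ℝ) ≤ r + 2))
      (by linarith : (0 : ℝ) ≤ r - 1)]
  obtain ⟨T, hTb, hT⟩ := exists_bounded_walk (M := N * C₀)
    (fun k => ⟨(abs_le.mp (hpart k 0 N (by norm_num) le_rfl)).1, hL k⟩)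
    (fun k => ⟨hR k, (abs_le.mp (hpart k 2 N le_rfl le_rfl)).2⟩)
  have hchoice : ∀ k, ∃ s : ℕ, s ≤ 2 ∧ T (k + 1) - T k = ∑ j ∈ Finset.range N, D k s j := by
    intro k
    rcases hT k with h | h
    · exact ⟨0, by norm_num, h⟩
    · exact ⟨2, le_rfl, h⟩
  choose s hs2 hs using hchoice
  let lam : ℤ → ℝ := fun n => P (n / N) (s (n / N)) (n % N).toNat
  have hlam : ∀ (k : ℤ) (j : ℕ), j < N → lam (k * N + j) = P k (s k) j := by
    intro k j hj
    obtain ⟨h1, h2⟩ := int_block_div_mod (k := k) hj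
    simp only [lam, h1, h2]
  let U : ℤ → ℝ := fun n => T (n / N) +
    ∑ i ∈ Finset.range (n % N).toNat, D (n / N) (s (n / N)) i
  have hU : ∀ (k : ℤ) (j : ℕ), j < N →
      U (k * N + j) = T k + ∑ i ∈ Finset.range j, D k (s k) i := by
    intro k j hj
    obtain ⟨h1, h2⟩ := int_block_div_mod (k := k) hj
    simp only [U, h1, h2]
  have hUb : ∀ n, |U n| ≤ 2 * (N * C₀) := by
    intro n
    obtain ⟨k, j, hj, rfl⟩ := exists_int_block hN n
    rw [hU k j hj]
    refine (abs_add_le _ _).trans ?_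
    linarith [hTb k, hpart k (s k) j (hs2 k) hj.le]
  have hmemΛ : ∀ n, lam n ∈ Λ := by
    intro n
    exact ((hp _).1 _ (hmod _)).1
  have hinj : Function.Injective lam := by
    intro n n' h
    obtain ⟨k, j, hj, rfl⟩ := exists_int_block hN n
    obtain ⟨k', j', hj', rfl⟩ := exists_int_block hN n'
    rw [hlam k j hj, hlam k' j' hj'] at h
    simp only [P] at h
    set I := k * w + (j / w : ℕ) + s k with hI
    set I' := k' * w + (j' / w : ℕ) + s k' with hI'
    obtain ⟨-, h1, h2⟩ := (hp I).1 (j % w) (hmod j)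
    obtain ⟨-, h1', h2'⟩ := (hp I').1 (j' % w) (hmod j')
    have hII : I = I' := by
      have a1 : (I : ℝ) < I' + 1 := by
        by_contra hcon
        nlinarith [not_lt.mp hcon]
      have a2 : (I' : ℝ) < I + 1 := by
        by_contra hcon
        nlinarith [not_lt.mp hcon]
      have a1' : I < I' + 1 := by exact_mod_cast a1
      have a2' : I' < I + 1 := by exact_mod_cast a2
      omega
    rw [← hII] at h
    have hmm := (hp I).2 _ (hmod j) _ (hmod j') h
    have hu : j / w + s k < w := by have := hdiv j hj; have := hs2 k; omega
    have hu' : j' / w + s k' < w := by have := hdiv j' hj'; have := hs2 k'; omega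
    obtain ⟨b1, b2⟩ := int_block_div_mod (k := k) hu
    obtain ⟨b1', b2'⟩ := int_block_div_mod (k := k') hu'
    have hEq : k * (w : ℤ) + ((j / w + s k : ℕ) : ℤ) = k' * w + ((j' / w + s k' : ℕ) : ℤ) := by
      push_cast
      rw [hI, hI'] at hII
      push_cast at hII
      linarith
    rw [hEq] at b1 b2
    have hkk : k = k' := b1.symm.trans b1'
    subst hkk
    have hjj : j / w = j' / w := by
      have := b2.symm.trans b2'
      omega
    have : j = j' := by rw [← Nat.div_add_mod j w, ← Nat.div_add_mod j' w, hjj, hmm]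
    rw [this]
  have hbig : C₀ ≤ 4 * (N * C₀) := by
    have : (1 : ℝ) ≤ N := by exact_mod_cast hN
    nlinarith
  refine ⟨4 * (N * C₀), min δ 1, lam, lt_min hδ one_pos, min_le_right _ _, hmemΛ,
    fun n => ?_, fun k m hkm => ?_, U, fun n => ?_, fun m n => ?_⟩
  · obtain ⟨k, j, hj, rfl⟩ := exists_int_block hN n
    rw [hlam k j hj]
    exact (hDC k (s k) j (hs2 k) hj).trans hbig
  · exact (min_le_left _ _).trans (hsep _ (hmemΛ k) _ (hmemΛ m) fun h => hkm (hinj h))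
  · obtain ⟨k, j, hj, rfl⟩ := exists_int_block hN n
    rw [hlam k j hj, hU k j hj]
    rcases Nat.lt_or_ge (j + 1) N with hj1 | hj1
    · have := hU k (j + 1) hj1
      push_cast at this
      rw [add_assoc, this, Finset.sum_range_succ]
      simp only [D]
      push_cast
      ring
    · have hjN : j + 1 = N := by omega
      have h1 : k * (N : ℤ) + j + 1 = (k + 1) * N + (0 : ℕ) := by
        rw [← hjN]; push_cast; ring
      have h2 := hs k
      have h3 : ∑ i ∈ Finset.range N, D k (s k) i =
          ∑ i ∈ Finset.range j, D k (s k) i + D k (s k) j := by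
        rw [← Finset.sum_range_succ, hjN]
      have h4 : D k (s k) j = P k (s k) j - ((k * N + j : ℤ) : ℝ) := rfl
      rw [h1, hU (k + 1) 0 hN, Finset.range_zero, Finset.sum_empty, add_zero]
      linarith
  · have h1 := hUb m
    have h2 := hUb n
    rw [zero_mul, add_zero]
    refine (abs_sub _ _).trans ?_
    linarith

lemma memℓp_two_iff {ι : Type*} {c : ι → ℂ} : Memℓp c 2 ↔ Summable fun n => ‖c n‖ ^ 2 := by
  rw [memℓp_gen_iff (by norm_num)]
  simp

/-- The element of the shift-invariant space with coefficient sequence `c`. -/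
def sechSeries (a b : ℂ) (c : ℤ → ℂ) (x : ℝ) : ℂ := ∑' n : ℤ, sechGen a b (x - n) * c n

lemma hasSum_sechSeries {a b : ℂ} (ha : 0 < a.re) (hb : 0 < b.re) {c : ℤ → ℂ}
    (hc : Summable fun n => ‖c n‖ ^ 2) (x : ℝ) :
    HasSum (fun n : ℤ => sechGen a b (x - n) * c n) (sechSeries a b c x) := by
  have hε := lt_min ha hb
  obtain ⟨D, hD, hg⟩ := exists_norm_sechGen_le hε (min_le_left _ _) (min_le_right _ _)
  have h := norm_sechGen_sub_le hε hD hg (lam := fun k => k + x) (C := |x|) (fun k => by simp) 0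
  simp only [Int.cast_zero, zero_add] at h
  have h' := summable_kernel_mul hε 0 (fun n => by simpa using h n) (norm_le_sqrt_tsum hc)
  exact h'.of_norm.hasSum

lemma inV2_sechGen_iff {a b : ℂ} (ha : 0 < a.re) (hb : 0 < b.re) {f : ℝ → ℂ} :
    InV2 (sechGen a b) f ↔ ∃ c : ℤ → ℂ, (Summable fun n => ‖c n‖ ^ 2) ∧ f = sechSeries a b c := by
  unfold InV2
  refine exists_congr fun c => ?_
  rw [memℓp_two_iff]
  refine and_congr_right fun hc => ?_
  simp only [mul_comm (c _)]
  constructor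
  · exact fun h => funext fun x => (h x).unique (hasSum_sechSeries ha hb hc x)
  · rintro rfl
    exact hasSum_sechSeries ha hb hc

lemma measurable_sechSeries {a b : ℂ} (ha : 0 < a.re) (hb : 0 < b.re) {c : ℤ → ℂ}
    (hc : Summable fun n => ‖c n‖ ^ 2) : Measurable (sechSeries a b c) := by
  have hcont : Continuous (sechGen a b) := continuous_sechGen (by simp; linarith)
  refine measurable_of_tendsto_metrizable' atTop
    (f := fun (s : Finset ℤ) (x : ℝ) => ∑ n ∈ s, sechGen a b (x - n) * c n) (fun s => ?_)
    (tendsto_pi_nhds.2 fun x => hasSum_sechSeries ha hb hc x)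
  exact Continuous.measurable (by fun_prop)

lemma exists_tsum_sechSeries_le {a b : ℂ} (ha : 0 < a.re) (hb : 0 < b.re) (C : ℝ) :
    ∃ B : ℝ, 0 < B ∧ ∀ lam : ℤ → ℝ, (∀ k, |lam k - k| ≤ C) → ∀ c : ℤ → ℂ,
      (Summable fun n => ‖c n‖ ^ 2) →
      (Summable fun m => ‖sechSeries a b c (lam m)‖ ^ 2) ∧
      ∑' m, ‖sechSeries a b c (lam m)‖ ^ 2 ≤ B * ∑' n, ‖c n‖ ^ 2 := by
  have hε := lt_min ha hb
  obtain ⟨D, hD, hg⟩ := exists_norm_sechGen_le hε (min_le_left _ _) (min_le_right _ _)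
  have := expMass_pos hε
  exact ⟨(D * Real.exp (min a.re b.re * C) * expMass (min a.re b.re)) ^ 2, by positivity,
    fun lam hlam c hc => schur_test hε (norm_sechGen_sub_le hε hD hg hlam) hc⟩

/-- The inverse kernel of a near-integer sequence reconstructs coefficients from samples, and
samples from data. -/
lemma exists_reconstruction {a b : ℂ} (ha : 0 < a.re) (hb : 0 < b.re) {C δ η : ℝ}
    (hδ : 0 < δ) (hδ1 : δ ≤ 1) (hη : (a + b).re * η ≤ min a.re b.re / 2) {lam : ℤ → ℝ}
    (hlam : IsNearInt C δ η lam) :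
    ∃ K : ℤ → ℤ → ℂ,
      (∀ n m, ‖K n m‖ ≤ sectionBound (a + b).re C δ *
        Real.exp (-(min a.re b.re / 2) * |(n : ℝ) - m|)) ∧
      ∀ c : ℤ → ℂ, (Summable fun n => ‖c n‖ ^ 2) →
        (∀ n, ∑' m, K n m * sechSeries a b c (lam m) = c n) ∧
        ∀ m, sechSeries a b (fun n => ∑' k, K n k * c k) (lam m) = c m := by
  have hε := lt_min ha hb
  obtain ⟨D, hD, hg⟩ := exists_norm_sechGen_le hε (min_le_left _ _) (min_le_right _ _)
  obtain ⟨K, hK, hKl, hKr⟩ :=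
    exists_inverse ha hb hε hδ hδ1 (min_le_left _ _) (min_le_right _ _) hη hlam
  have hgl : ∀ m n : ℤ, ‖sechGen a b (lam m - n)‖ ≤ D * Real.exp (min a.re b.re * C) *
      Real.exp (-(min a.re b.re / 2) * |(m : ℝ) - n|) := fun m n => by
    refine (norm_sechGen_sub_le hε hD hg hlam.near m n).trans ?_
    have := abs_nonneg ((m : ℝ) - n)
    gcongr
    linarith
  refine ⟨K, hK, fun c hc => ⟨fun n => ?_, fun m => ?_⟩⟩
  · have h := tsum_kernel_assoc (half_pos hε) hK hgl (norm_le_sqrt_tsum hc) n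
    simp only [hKl, ite_mul, one_mul, zero_mul, tsum_ite_eq'] at h
    exact h
  · have h := tsum_kernel_assoc (half_pos hε) hgl hK (norm_le_sqrt_tsum hc) m
    simp only [hKr, ite_mul, one_mul, zero_mul, tsum_ite_eq'] at h
    exact h

lemma exists_le_tsum_sechSeries {a b : ℂ} (ha : 0 < a.re) (hb : 0 < b.re) (C : ℝ) {δ η : ℝ}
    (hδ : 0 < δ) (hδ1 : δ ≤ 1) (hη : (a + b).re * η ≤ min a.re b.re / 2) :
    ∃ B : ℝ, 0 < B ∧ ∀ lam : ℤ → ℝ, IsNearInt C δ η lam → ∀ c : ℤ → ℂ,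
      (Summable fun n => ‖c n‖ ^ 2) →
      ∑' n, ‖c n‖ ^ 2 ≤ B * ∑' m, ‖sechSeries a b c (lam m)‖ ^ 2 := by
  have hε := lt_min ha hb
  have hS : 0 < sectionBound (a + b).re C δ := Real.exp_pos _
  have hE := expMass_pos (half_pos hε)
  refine ⟨(sectionBound (a + b).re C δ * expMass (min a.re b.re / 2)) ^ 2, by positivity,
    fun lam hlam c hc => ?_⟩
  obtain ⟨K, hK, hKc⟩ := exists_reconstruction ha hb hδ hδ1 hη hlam
  obtain ⟨B, -, hB⟩ := exists_tsum_sechSeries_le ha hb C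
  have h := (schur_test (half_pos hε) hK (hB lam hlam.near c hc).1).2
  simpa only [(hKc c hc).1] using h

lemma lintegral_eq_lintegral_tsum_add_int {F : ℝ → ENNReal} (hF : Measurable F) :
    ∫⁻ x, F x = ∫⁻ t in Set.Ioc (0 : ℝ) 1, ∑' n : ℤ, F (n + t) := by
  rw [lintegral_tsum fun n => by fun_prop, ← setLIntegral_univ, ← iUnion_Ioc_intCast ℝ,
    lintegral_iUnion (fun n => measurableSet_Ioc) (Set.pairwise_disjoint_Ioc_intCast ℝ)]
  refine tsum_congr fun n => ?_
  rw [← (measurePreserving_add_left volume (n : ℝ)).setLIntegral_comp_preimage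
    measurableSet_Ioc hF]
  simp

lemma isNearInt_add_const {t η : ℝ} (ht : 0 ≤ t) (htη : t ≤ η) (hη : η ≤ 1) :
    IsNearInt 1 1 η fun k => (k : ℝ) + t where
  near k := by rw [add_sub_cancel_left, abs_of_nonneg ht]; linarith
  sep k m h := by
    rw [add_sub_add_right_eq_sub]
    exact one_le_abs_intCast_sub h
  potential := by
    refine ⟨fun k => t * k, fun k => by push_cast; ring, fun m n => ?_⟩
    rw [← mul_sub, abs_mul, abs_of_nonneg ht]
    have := mul_le_mul_of_nonneg_right htη (abs_nonneg ((m : ℝ) - n))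
    linarith

/-- The `L²` norm of a series is comparable with the `ℓ²` norm of its coefficients. -/
lemma exists_integral_sechSeries_bounds {a b : ℂ} (ha : 0 < a.re) (hb : 0 < b.re) :
    ∃ A B : ℝ, 0 < A ∧ 0 < B ∧ ∀ c : ℤ → ℂ, (Summable fun n => ‖c n‖ ^ 2) →
      A * ∑' n, ‖c n‖ ^ 2 ≤ ∫ x, ‖sechSeries a b c x‖ ^ 2 ∧
      ∫ x, ‖sechSeries a b c x‖ ^ 2 ≤ B * ∑' n, ‖c n‖ ^ 2 := by
  have hε := lt_min ha hb
  have hσ : 0 < (a + b).re := by simp; linarith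
  obtain ⟨η, hη0, hη1, hη⟩ : ∃ η : ℝ, 0 < η ∧ η ≤ 1 ∧ (a + b).re * η ≤ min a.re b.re / 2 := by
    refine ⟨min 1 (min a.re b.re / 2 / (a + b).re), by positivity, min_le_left _ _, ?_⟩
    calc (a + b).re * min 1 (min a.re b.re / 2 / (a + b).re)
        ≤ (a + b).re * (min a.re b.re / 2 / (a + b).re) := by
          gcongr
          exact min_le_right _ _
      _ = _ := by field_simp
  obtain ⟨B, hB, hup⟩ := exists_tsum_sechSeries_le ha hb 1
  obtain ⟨B', hB', hlow⟩ := exists_le_tsum_sechSeries ha hb 1 one_pos le_rfl hη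
  refine ⟨η / B', B, by positivity, hB, fun c hc => ?_⟩
  have hmeas := measurable_sechSeries ha hb hc
  set S := ∑' n, ‖c n‖ ^ 2
  have hS : 0 ≤ S := tsum_nonneg fun _ => sq_nonneg _
  have hup' : ∀ t ∈ Set.Ioc (0 : ℝ) 1, _ := fun t ht =>
    hup (fun k => k + t) (isNearInt_add_const ht.1.le ht.2 le_rfl).near c hc
  have hintegral : ∫⁻ x, ENNReal.ofReal (‖sechSeries a b c x‖ ^ 2) =
      ∫⁻ t in Set.Ioc (0 : ℝ) 1, ENNReal.ofReal (∑' n : ℤ, ‖sechSeries a b c (n + t)‖ ^ 2) := by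
    rw [lintegral_eq_lintegral_tsum_add_int (by fun_prop)]
    refine setLIntegral_congr_fun measurableSet_Ioc fun t ht => ?_
    exact (ENNReal.ofReal_tsum_of_nonneg (fun _ => sq_nonneg _) (hup' t ht).1).symm
  have hle : ∫⁻ x, ENNReal.ofReal (‖sechSeries a b c x‖ ^ 2) ≤ ENNReal.ofReal (B * S) := by
    rw [hintegral]
    refine (setLIntegral_mono measurable_const fun t ht =>
      ENNReal.ofReal_le_ofReal (hup' t ht).2).trans ?_
    simp [S]
  have hge : ENNReal.ofReal (η / B' * S) ≤ ∫⁻ x, ENNReal.ofReal (‖sechSeries a b c x‖ ^ 2) := by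
    rw [hintegral]
    refine le_trans ?_ (lintegral_mono_set (Set.Ioc_subset_Ioc_right hη1))
    calc ENNReal.ofReal (η / B' * S) = ∫⁻ _ in Set.Ioc (0 : ℝ) η, ENNReal.ofReal (S / B') := by
          rw [setLIntegral_const, Real.volume_Ioc, sub_zero, ← ENNReal.ofReal_mul (by positivity)]
          congr 1
          ring
      _ ≤ _ := by
          refine setLIntegral_mono' measurableSet_Ioc fun t ht => ENNReal.ofReal_le_ofReal ?_
          rw [div_le_iff₀' hB']
          exact hlow _ (isNearInt_add_const ht.1.le ht.2 hη1) c hc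
  rw [integral_eq_lintegral_of_nonneg_ae (ae_of_all _ fun _ => sq_nonneg _)
    (by fun_prop : Measurable fun x => ‖sechSeries a b c x‖ ^ 2).aestronglyMeasurable]
  constructor
  · exact (ENNReal.ofReal_le_iff_le_toReal (hle.trans_lt ENNReal.ofReal_lt_top).ne).mp hge
  · exact ENNReal.toReal_le_of_le_ofReal (by positivity) hle

lemma isSamplingSet_range {a b : ℂ} (ha : 0 < a.re) (hb : 0 < b.re) {C δ : ℝ}
    (hδ : 0 < δ) (hδ1 : δ ≤ 1) {lam : ℤ → ℝ} (hinj : Function.Injective lam)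
    (hlam : IsNearInt C δ 0 lam) : IsSamplingSet (sechGen a b) (Set.range lam) := by
  have hε := lt_min ha hb
  obtain ⟨A, B, hA, hB, hintegral⟩ := exists_integral_sechSeries_bounds ha hb
  obtain ⟨B₁, hB₁, hup⟩ := exists_tsum_sechSeries_le ha hb C
  obtain ⟨B₂, hB₂, hlow⟩ := exists_le_tsum_sechSeries ha hb C hδ hδ1 (η := 0)
    (by rw [mul_zero]; positivity)
  refine ⟨(B * B₂)⁻¹, B₁ / A, by positivity, by positivity, fun f hf => ?_⟩
  obtain ⟨c, hc, rfl⟩ := (inV2_sechGen_iff ha hb).mp hf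
  rw [← (Equiv.ofInjective lam hinj).tsum_eq]
  simp only [Equiv.ofInjective_apply]
  obtain ⟨hi1, hi2⟩ := hintegral c hc
  constructor
  · rw [inv_mul_le_iff₀ (by positivity), mul_assoc]
    exact hi2.trans (mul_le_mul_of_nonneg_left (hlow lam hlam c hc) hB.le)
  · refine (hup lam hlam.near c hc).2.trans ?_
    rw [div_mul_eq_mul_div, mul_div_assoc]
    refine mul_le_mul_of_nonneg_left ?_ hB₁.le
    rwa [le_div_iff₀' hA]

lemma isInterpolatingSet_range {a b : ℂ} (ha : 0 < a.re) (hb : 0 < b.re) {C δ : ℝ}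
    (hδ : 0 < δ) (hδ1 : δ ≤ 1) {lam : ℤ → ℝ} (hinj : Function.Injective lam)
    (hlam : IsNearInt C δ 0 lam) : IsInterpolatingSet (sechGen a b) (Set.range lam) := by
  intro d hd
  have hε := lt_min ha hb
  obtain ⟨K, hK, hKc⟩ := exists_reconstruction ha hb hδ hδ1 (η := 0)
    (by rw [mul_zero]; positivity) hlam
  let e := Equiv.ofInjective lam hinj
  have hd' : Summable fun m => ‖d (e m)‖ ^ 2 := e.summable_iff.mpr (memℓp_two_iff.mp hd)
  refine ⟨_, (inV2_sechGen_iff ha hb).mpr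
    ⟨_, (schur_test (half_pos hε) hK hd').1, rfl⟩, fun l => ?_⟩
  obtain ⟨m, rfl⟩ := e.surjective l
  exact (hKc _ hd').2 m

/-- a separated set with lower Beurling density greater than 1 contains a
complete interpolating sequence for `V²(g)`. -/
theorem statement2 (a b : ℂ) (ha : 0 < a.re) (hb : 0 < b.re)
    (g : ℝ → ℂ) (hg : ∀ x : ℝ, g x = 1 / (Complex.exp (a * x) + Complex.exp (-b * x)))
    (Λ : Set ℝ) (hΛ : Separated Λ) (hd : 1 < lowerDensity Λ) :
    ∃ Λ' : Set ℝ, Λ' ⊆ Λ ∧ IsSamplingSet g Λ' ∧ IsInterpolatingSet g Λ' := by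
  obtain rfl : g = sechGen a b := funext hg
  obtain ⟨C, δ, lam, hδ, hδ1, hmem, hlam⟩ := exists_nearInt_of_lowerDensity hΛ hd
  have hinj : Function.Injective lam := fun k m h => by
    by_contra hne
    have := hlam.sep k m hne
    rw [h, sub_self, abs_zero] at this
    linarith
  exact ⟨Set.range lam, Set.range_subset_iff.mpr hmem,
    isSamplingSet_range ha hb hδ hδ1 hinj hlam, isInterpolatingSet_range ha hb hδ hδ1 hinj hlam⟩

end
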